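/- arXiv:2407.14240 — 6 statements merged into one kernel-verified Lean document; each statement's English description precedes it below -/
import Mathlib

section
/- Let q be a prime power, F a finite field with q elements, n ≥ 1, and 0 ≤ k ≤ n. Let ψ₀ : F → ℂ× be a nontrivial additive character and let A_k ∈ M(n,F) be the block matrix with identity I_k in the upper-left k×k block and zeros elsewhere. Let π : GL(2n,F) → GL(V) be a finite-dimensional complex representation with character Θ such that for every X ∈ M(n,F), Θ of the block upper-triangular unipotent matrix u(X) = [[I_n, X],[0, I_n]] equals (-1)^{2n-1} ∏_{i=1}^{2n - rank(X) - 1} (1 - q^i). Then the dimension of the subspace {v ∈ V : π(u(X)) v = ψ₀(tr(A_k X)) · v for all X ∈ M(n,F)} equals (-1)^{n-1} (∏_{i=1}^{n-1}(1 - q^i)) · q^{k(k-1)/2} · ∏_{j=k}^{n-1}(q^j - 1). -/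
open Matrix Finset

noncomputable section

/-- The block upper-triangular unipotent matrix `[[1, X], [0, 1]]`, as an element of
`GL(2n, F)` (realized as invertible `(Fin n ⊕ Fin n)`-indexed matrices). -/
def uMat {F : Type*} [Field F] {n : ℕ} (X : Matrix (Fin n) (Fin n) F) :
    (Matrix (Fin n ⊕ Fin n) (Fin n ⊕ Fin n) F)ˣ where
  val := Matrix.fromBlocks 1 X 0 1
  inv := Matrix.fromBlocks 1 (-X) 0 1
  val_inv := by simp [Matrix.fromBlocks_multiply, ← Matrix.fromBlocks_one]
  inv_val := by simp [Matrix.fromBlocks_multiply, ← Matrix.fromBlocks_one]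

/-- The `n × n` matrix with the identity `I_k` in the upper-left `k × k` block
and zeros elsewhere. -/
def Ak (F : Type*) [Zero F] [One F] (n k : ℕ) : Matrix (Fin n) (Fin n) F :=
  Matrix.of fun i j => if i = j ∧ (i : ℕ) < k then 1 else 0

section QBinomial

variable {F V : Type*} [Field F] [AddCommGroup V] [Module F V]

theorem inf_ker_sup_span_singleton {φ : V →ₗ[F] F} {x : V} (hx : φ x = 1)
    {W : Submodule F V} (hxW : x ∈ W) : W ⊓ LinearMap.ker φ ⊔ Submodule.span F {x} = W := by
  refine le_antisymm (sup_le inf_le_left (by simpa using hxW)) fun y hy => ?_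
  have h : y = (y - φ y • x) + φ y • x := by abel
  rw [h]
  refine Submodule.add_mem_sup ⟨W.sub_mem hy (W.smul_mem _ hxW), ?_⟩
    (Submodule.smul_mem _ _ (Submodule.mem_span_singleton_self x))
  simp [hx]

theorem sup_span_singleton_inf_ker {φ : V →ₗ[F] F} {x : V} (hx : φ x = 1)
    {W : Submodule F V} (hW : W ≤ LinearMap.ker φ) :
    (W ⊔ Submodule.span F {x}) ⊓ LinearMap.ker φ = W := by
  refine le_antisymm ?_ (le_inf le_sup_left hW)
  rintro y ⟨hy, hy0⟩
  obtain ⟨w, hw, z, hz, rfl⟩ := Submodule.mem_sup.1 hy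
  obtain ⟨c, rfl⟩ := Submodule.mem_span_singleton.1 hz
  have hw0 : φ w = 0 := hW hw
  have hc : c = 0 := by simpa [hx, hw0] using hy0
  simpa [hc] using hw

variable [Fintype V]

theorem finrank_eq_finrank_inf_ker_add_one {φ : V →ₗ[F] F} {x : V} (hx : φ x = 1)
    {W : Submodule F V} (hxW : x ∈ W) :
    Module.finrank F W = Module.finrank F ↥(W ⊓ LinearMap.ker φ) + 1 := by
  have hx0 : x ≠ 0 := by rintro rfl; simp at hx
  have hdisj : W ⊓ LinearMap.ker φ ⊓ Submodule.span F {x} = ⊥ := by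
    rw [eq_bot_iff]
    rintro y ⟨⟨-, hy⟩, hz⟩
    obtain ⟨c, rfl⟩ := Submodule.mem_span_singleton.1 hz
    have hc : c = 0 := by simpa [hx] using hy
    simp [hc]
  have h := Submodule.finrank_sup_add_finrank_inf_eq (W ⊓ LinearMap.ker φ) (Submodule.span F {x})
  rwa [inf_ker_sup_span_singleton hx hxW, hdisj, finrank_bot, finrank_span_singleton hx0,
    add_zero] at h

variable [Fintype F]

open scoped Classical in
theorem card_filter_mem_apply_eq_one {φ : V →ₗ[F] F} {x : V} (hx : φ x = 1)
    {W : Submodule F V} (hxW : x ∈ W) :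
    #{y : V | y ∈ W ∧ φ y = 1} =
      Fintype.card F ^ Module.finrank F ↥(W ⊓ LinearMap.ker φ) := by
  rw [← Module.card_eq_pow_finrank (V := ↥(W ⊓ LinearMap.ker φ)), Fintype.card_subtype]
  refine Finset.card_bij' (fun y _ => y - x) (fun y _ => y + x) ?_ ?_ ?_ ?_
  · intro y hy
    simp only [mem_filter, mem_univ, true_and] at hy
    simpa [hx, hy.2] using W.sub_mem hy.1 hxW
  · intro y hy
    simp only [mem_filter, mem_univ, true_and, Submodule.mem_inf, LinearMap.mem_ker] at hy
    simpa [hx, hy.2] using W.add_mem hy.1 hxW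
  · simp
  · simp

variable [Fintype (Submodule F V)]

/-- Cauchy's `q`-binomial theorem, as a sum over the subspaces of a finite vector space. -/
theorem sum_submodule_le_eq_prod {R : Type*} [CommRing R] (a : R) (p : Submodule F V)
    [DecidablePred fun W : Submodule F V => W ≤ p] :
    ∑ W : Submodule F V with W ≤ p, (-a) ^ Module.finrank F W *
        (Fintype.card F : R) ^ (Module.finrank F W).choose 2 =
      ∏ i ∈ range (Module.finrank F p), (1 - a * (Fintype.card F : R) ^ i) := by
  classical
  induction hd : Module.finrank F p generalizing p with
  | zero =>
    have hp : p = ⊥ := Submodule.finrank_eq_zero.1 hd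
    subst hp
    have : ({W : Submodule F V | W ≤ ⊥} : Finset _) = {⊥} := by ext; simp
    rw [this]
    simp
  | succ d ih =>
    obtain ⟨v, hv, hv0⟩ : ∃ v ∈ p, v ≠ 0 := by
      refine p.exists_mem_ne_zero_of_ne_bot ?_
      rintro rfl
      simp at hd
    obtain ⟨φ, hφ⟩ := Module.Projective.exists_dual_eq_one F hv0
    have hrank := finrank_eq_finrank_inf_ker_add_one hφ hv
    have hH : Module.finrank F ↥(p ⊓ LinearMap.ker φ) = d := by omega
    have key : ∑ W : Submodule F V with W ≤ p ∧ ¬ W ≤ LinearMap.ker φ,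
        (-a) ^ Module.finrank F W * (Fintype.card F : R) ^ (Module.finrank F W).choose 2 =
        -a * (Fintype.card F : R) ^ d *
          ∑ W : Submodule F V with W ≤ p ⊓ LinearMap.ker φ, (-a) ^ Module.finrank F W *
            (Fintype.card F : R) ^ (Module.finrank F W).choose 2 := by
      calc
        _ = ∑ W : Submodule F V with W ≤ p ∧ ¬ W ≤ LinearMap.ker φ,
              ∑ x : V with x ∈ W ∧ φ x = 1, -a *
                ((-a) ^ Module.finrank F ↥(W ⊓ LinearMap.ker φ) * (Fintype.card F : R) ^
                  (Module.finrank F ↥(W ⊓ LinearMap.ker φ)).choose 2) := by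
          refine Finset.sum_congr rfl fun W hW => ?_
          simp only [mem_filter, mem_univ, true_and] at hW
          obtain ⟨y, hyW, hy⟩ := Set.not_subset.1 hW.2
          have hy0 : φ y ≠ 0 := hy
          have hx : φ ((φ y)⁻¹ • y) = 1 := by simp [hy0]
          have hxW := W.smul_mem (φ y)⁻¹ hyW
          rw [Finset.sum_const, card_filter_mem_apply_eq_one hx hxW,
            finrank_eq_finrank_inf_ker_add_one hx hxW, Nat.choose_succ_succ, Nat.choose_one_right,
            nsmul_eq_mul, pow_succ, pow_add]
          push_cast
          ring
        _ = ∑ x : V with x ∈ p ∧ φ x = 1, ∑ W : Submodule F V with W ≤ p ∧ x ∈ W, -a *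
                ((-a) ^ Module.finrank F ↥(W ⊓ LinearMap.ker φ) * (Fintype.card F : R) ^
                  (Module.finrank F ↥(W ⊓ LinearMap.ker φ)).choose 2) := by
          refine Finset.sum_comm' fun W x => ?_
          simp only [mem_filter, mem_univ, true_and]
          constructor
          · rintro ⟨⟨h1, -⟩, h2, h3⟩
            exact ⟨⟨h1, h2⟩, h1 h2, h3⟩
          · rintro ⟨⟨h1, h2⟩, -, h3⟩
            refine ⟨⟨h1, fun h => ?_⟩, h2, h3⟩
            have : φ x = 0 := h h2
            simp [this] at h3
        _ = ∑ x : V with x ∈ p ∧ φ x = 1,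
              ∑ W : Submodule F V with W ≤ p ⊓ LinearMap.ker φ, -a *
                ((-a) ^ Module.finrank F W *
                  (Fintype.card F : R) ^ (Module.finrank F W).choose 2) := by
          refine Finset.sum_congr rfl fun x hx => ?_
          simp only [mem_filter, mem_univ, true_and] at hx
          refine Finset.sum_bij' (fun W _ => W ⊓ LinearMap.ker φ)
            (fun W _ => W ⊔ Submodule.span F {x}) ?_ ?_ ?_ ?_ ?_
          · intro W hW
            simp only [mem_filter, mem_univ, true_and] at hW ⊢
            exact inf_le_inf_right _ hW.1
          · intro W hW
            simp only [mem_filter, mem_univ, true_and] at hW ⊢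
            exact ⟨sup_le (hW.trans inf_le_left) (by simpa using hx.1),
              Submodule.mem_sup_right (Submodule.mem_span_singleton_self x)⟩
          · intro W hW
            simp only [mem_filter, mem_univ, true_and] at hW
            exact inf_ker_sup_span_singleton hx.2 hW.2
          · intro W hW
            simp only [mem_filter, mem_univ, true_and] at hW
            exact sup_span_singleton_inf_ker hx.2 (hW.trans inf_le_right)
          · intro W hW
            rfl
        _ = _ := by
          rw [Finset.sum_const, card_filter_mem_apply_eq_one hφ hv, hH, ← Finset.mul_sum,
            nsmul_eq_mul]
          push_cast
          ring
    rw [← Finset.sum_filter_add_sum_filter_not _ (fun W => W ≤ LinearMap.ker φ),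
      Finset.filter_filter, Finset.filter_filter, key, Finset.prod_range_succ,
      ← ih (p ⊓ LinearMap.ker φ) hH]
    simp only [le_inf_iff]
    ring

theorem choose_two_add (m n : ℕ) : (m + n).choose 2 = m.choose 2 + m * n + n.choose 2 := by
  induction n with
  | zero => simp
  | succ n ih =>
    rw [← add_assoc, Nat.choose_succ_succ, Nat.choose_succ_succ n, Nat.choose_one_right,
      Nat.choose_one_right, ih]
    ring

theorem sum_le_submodule_eq_prod {R : Type*} [CommRing R] (U : Submodule F V)
    [DecidablePred fun W : Submodule F V => U ≤ W] :
    ∑ W : Submodule F V with U ≤ W, (-1 : R) ^ Module.finrank F W *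
        (Fintype.card F : R) ^ (Module.finrank F W).choose 2 =
      (-1) ^ Module.finrank F U * (Fintype.card F : R) ^ (Module.finrank F U).choose 2 *
        ∏ i ∈ Ico (Module.finrank F U) (Module.finrank F V), (1 - (Fintype.card F : R) ^ i) := by
  classical
  obtain ⟨C, hC⟩ := U.exists_isCompl
  have hdim := Submodule.finrank_add_eq_of_isCompl hC
  rw [Finset.prod_Ico_eq_prod_range, ← hdim, Nat.add_sub_cancel_left]
  simp only [pow_add]
  rw [← sum_submodule_le_eq_prod, Finset.mul_sum]
  symm
  refine Finset.sum_bij' (fun W _ => U ⊔ W) (fun W _ => W ⊓ C) ?_ ?_ ?_ ?_ ?_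
  · simp
  · simp
  · intro W hW
    simp only [mem_filter, mem_univ, true_and] at hW
    rw [sup_comm, sup_inf_assoc_of_le _ hW, hC.inf_eq_bot, sup_bot_eq]
  · intro W hW
    simp only [mem_filter, mem_univ, true_and] at hW
    rw [inf_comm, ← sup_inf_assoc_of_le _ hW, hC.sup_eq_top, top_inf_eq]
  · intro W hW
    simp only [mem_filter, mem_univ, true_and] at hW
    have h := Submodule.finrank_sup_add_finrank_inf_eq U W
    rw [(hC.disjoint.mono_right hW).eq_bot, finrank_bot, add_zero] at h
    rw [h, choose_two_add, neg_pow ((Fintype.card F : R) ^ _), ← pow_mul]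
    ring

end QBinomial

section Isotypic

variable {A G V : Type*} [AddCommGroup A] [Fintype A] [Group G] [AddCommGroup V] [Module ℂ V]
  [FiniteDimensional ℂ V]

theorem card_mul_finrank_invariants {H : Type*} [Group H] [Fintype H]
    (ρ : Representation ℂ H V) :
    (Fintype.card H : ℂ) * Module.finrank ℂ ρ.invariants =
      ∑ g, LinearMap.trace ℂ V (ρ g) := by
  have h0 : (Fintype.card H : ℂ) ≠ 0 := Nat.cast_ne_zero.2 Fintype.card_ne_zero
  let : Invertible (Fintype.card H : ℂ) := invertibleOfNonzero h0
  rw [← (ρ.isProj_averageMap).trace]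
  simp [GroupAlgebra.average, map_sum, h0]

theorem card_mul_finrank_iInf_eigenspace (π : Representation ℂ G V) (u : Multiplicative A →* G)
    (χ : AddChar A ℂˣ) :
    (Fintype.card A : ℂ) * Module.finrank ℂ
        ↥(⨅ x : A, Module.End.eigenspace (π (u (.ofAdd x))) ((χ x : ℂˣ) : ℂ)) =
      ∑ x, ((χ (-x) : ℂˣ) : ℂ) * LinearMap.trace ℂ V (π (u (.ofAdd x))) := by
  let ρ : Representation ℂ (Multiplicative A) V :=
    { toFun x := ((χ (-x.toAdd) : ℂˣ) : ℂ) • π (u x)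
      map_one' := by simp
      map_mul' x y := by
        rw [toAdd_mul, neg_add, AddChar.map_add_eq_mul, map_mul, map_mul, smul_mul_smul_comm,
          Units.val_mul] }
  have hρ : (⨅ x : A, Module.End.eigenspace (π (u (.ofAdd x))) ((χ x : ℂˣ) : ℂ)) =
      ρ.invariants := by
    ext v
    simp only [Submodule.mem_iInf, Module.End.mem_eigenspace_iff, Representation.mem_invariants]
    refine ⟨fun h g => ?_, fun h x => ?_⟩
    · have := h g.toAdd
      rw [ofAdd_toAdd] at this
      change ((χ (-g.toAdd) : ℂˣ) : ℂ) • π (u g) v = v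
      rw [this, smul_smul, ← Units.val_mul, ← AddChar.map_add_eq_mul]
      simp
    · have : ((χ (-x) : ℂˣ) : ℂ) • π (u (.ofAdd x)) v = v := h (.ofAdd x)
      nth_rw 2 [← this]
      rw [smul_smul, ← Units.val_mul, ← AddChar.map_add_eq_mul]
      simp
  rw [hρ, ← Fintype.card_multiplicative A, card_mul_finrank_invariants]
  refine Fintype.sum_equiv Multiplicative.toAdd _ _ fun x => ?_
  change LinearMap.trace ℂ V (((χ (-x.toAdd) : ℂˣ) : ℂ) • π (u x)) = _
  simp

end Isotypic

section Fourier

variable {F : Type*} [Field F] {n : ℕ}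

/-- The matrices whose kernel contains a given subspace. -/
def matricesVanishingOn (W : Submodule F (Fin n → F)) :
    Submodule F (Matrix (Fin n) (Fin n) F) where
  carrier := {X | W ≤ LinearMap.ker X.mulVecLin}
  add_mem' {X Y} hX hY w hw := by
    have h1 : X *ᵥ w = 0 := hX hw
    have h2 : Y *ᵥ w = 0 := hY hw
    simp [h1, h2]
  zero_mem' w _ := by simp
  smul_mem' c X hX w hw := by
    have h1 : X *ᵥ w = 0 := hX hw
    simp [h1]

theorem mem_matricesVanishingOn {W : Submodule F (Fin n → F)} {X : Matrix (Fin n) (Fin n) F} :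
    X ∈ matricesVanishingOn W ↔ W ≤ LinearMap.ker X.mulVecLin := Iff.rfl

theorem finrank_matricesVanishingOn (W : Submodule F (Fin n → F)) :
    Module.finrank F (matricesVanishingOn W) + n * Module.finrank F W = n * n := by
  let r : Matrix (Fin n) (Fin n) F →ₗ[F] (W →ₗ[F] (Fin n → F)) :=
    (LinearMap.lcomp F (Fin n → F) W.subtype).comp
      (Matrix.toLin' : Matrix (Fin n) (Fin n) F ≃ₗ[F] _).toLinearMap
  have hker : LinearMap.ker r = matricesVanishingOn W := by
    ext X
    simp only [LinearMap.mem_ker, mem_matricesVanishingOn]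
    exact ⟨fun h w hw => LinearMap.congr_fun h ⟨w, hw⟩, fun h => LinearMap.ext fun w => h w.2⟩
  have hrange : LinearMap.range r = ⊤ := by
    rw [LinearMap.range_eq_top]
    intro f
    obtain ⟨g, hg⟩ := f.exists_extend
    exact ⟨LinearMap.toMatrix' g, by simpa [r, LinearMap.lcomp_apply'] using hg⟩
  have h := r.finrank_range_add_finrank_ker
  rw [hker, hrange, finrank_top, Module.finrank_linearMap, Module.finrank_matrix] at h
  simp at h
  linarith

theorem sum_addChar_trace_mul [Fintype F] {ψ : AddChar F ℂˣ} (hψ : ψ ≠ 1) (A : Matrix (Fin n) (Fin n) F)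
    (W : Submodule F (Fin n → F))
    [DecidablePred fun X : Matrix (Fin n) (Fin n) F => W ≤ LinearMap.ker X.mulVecLin]
    [Decidable (LinearMap.range A.mulVecLin ≤ W)] :
    (Fintype.card F : ℂ) ^ (n * Module.finrank F W) *
      ∑ X : Matrix (Fin n) (Fin n) F with W ≤ LinearMap.ker X.mulVecLin,
        ((ψ (Matrix.trace (A * X)) : ℂˣ) : ℂ) =
      if LinearMap.range A.mulVecLin ≤ W then (Fintype.card F : ℂ) ^ (n * n) else 0 := by
  classical
  let χ : AddChar (matricesVanishingOn W) ℂ :=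
    { toFun X := ((ψ (Matrix.trace (A * X.1)) : ℂˣ) : ℂ)
      map_zero_eq_one' := by simp
      map_add_eq_mul' X Y := by simp [mul_add, AddChar.map_add_eq_mul] }
  have hsum : ∑ X : Matrix (Fin n) (Fin n) F with W ≤ LinearMap.ker X.mulVecLin,
      ((ψ (Matrix.trace (A * X)) : ℂˣ) : ℂ) = ∑ X, χ X :=
    Finset.sum_subtype _ (by simp [mem_matricesVanishingOn]) _
  have hχ : χ = 0 ↔ LinearMap.range A.mulVecLin ≤ W := by
    constructor
    · intro h
      by_contra hA
      obtain ⟨_, ⟨z, rfl⟩, hz⟩ := Set.not_subset.1 hA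
      obtain ⟨φ, hφ, hW⟩ := Submodule.exists_le_ker_of_notMem hz
      obtain ⟨t, ht⟩ := AddChar.ne_one_iff.1 hψ
      set s := φ (A.mulVecLin z)
      set w : Fin n → F := fun i => φ (Pi.single i 1) with hw
      have hdot : ∀ v, w ⬝ᵥ v = φ v := fun v => by
        conv_rhs => rw [pi_eq_sum_univ' v]
        simp [dotProduct, hw, mul_comm]
      have hmem : Matrix.vecMulVec ((t * s⁻¹) • z) w ∈ matricesVanishingOn W := by
        intro v hv
        have : φ v = 0 := hW hv
        simp [Matrix.vecMulVec_mulVec, hdot, this]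
      refine ht ?_
      have h1 : χ ⟨_, hmem⟩ = 1 := by rw [h]; rfl
      have h2 : Matrix.trace (A * Matrix.vecMulVec ((t * s⁻¹) • z) w) = t := by
        rw [Matrix.mul_vecMulVec, Matrix.trace_vecMulVec, dotProduct_comm, hdot,
          Matrix.mulVec_smul, map_smul, smul_eq_mul]
        change t * s⁻¹ * s = t
        field_simp
      have h3 : ((ψ (Matrix.trace (A * Matrix.vecMulVec ((t * s⁻¹) • z) w)) : ℂˣ) : ℂ) = 1 := h1
      rw [h2] at h3
      exact Units.ext h3
    · intro h
      ext X
      have hX : X.1 * A = 0 := by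
        refine Matrix.toLin'.injective (LinearMap.ext fun v => ?_)
        have : X.1 *ᵥ (A *ᵥ v) = 0 := X.2 (h ⟨v, rfl⟩)
        simpa using this
      change ((ψ (Matrix.trace (A * X.1)) : ℂˣ) : ℂ) = 1
      rw [Matrix.trace_mul_comm, hX]
      simp
  rw [hsum, AddChar.sum_eq_ite]
  simp only [hχ]
  split_ifs
  · rw [Module.card_eq_pow_finrank (K := F) (V := matricesVanishingOn W), Nat.cast_pow, ← pow_add,
      add_comm, finrank_matricesVanishingOn]
  · simp

end Fourier

/-- `uMat` as a group homomorphism. -/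
def uMatHom (F : Type*) [Field F] (n : ℕ) :
    Multiplicative (Matrix (Fin n) (Fin n) F) →*
      (Matrix (Fin n ⊕ Fin n) (Fin n ⊕ Fin n) F)ˣ where
  toFun X := uMat X.toAdd
  map_one' := Units.ext (by simp [uMat])
  map_mul' X Y := Units.ext (by simp [uMat, Matrix.fromBlocks_multiply, add_comm])

theorem Ak_eq_diagonal (F : Type*) [Field F] (n k : ℕ) :
    Ak F n k = Matrix.diagonal fun i : Fin n => if (i : ℕ) < k then 1 else 0 := by
  ext i j
  by_cases h : i = j <;> simp [Ak, Matrix.diagonal, h]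

theorem rank_Ak (F : Type*) [Field F] {n k : ℕ} (hk : k ≤ n) : (Ak F n k).rank = k := by
  classical
  rw [Ak_eq_diagonal, Matrix.rank_diagonal]
  have : Fintype.card {i : Fin n // (i : ℕ) < k} = k := by
    rw [Fintype.card_congr (Fin.castLEquiv hk).symm]
    simp
  simpa using this

theorem prod_Icc_add (R : Type*) [CommRing R] (q : R) {n : ℕ} (hn : 1 ≤ n) (d : ℕ) :
    ∏ i ∈ Icc 1 (n - 1 + d), (1 - q ^ i) =
      (∏ i ∈ Icc 1 (n - 1), (1 - q ^ i)) * ∏ i ∈ range d, (1 - q ^ n * q ^ i) := by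
  induction d with
  | zero => simp
  | succ d ih =>
    rw [← add_assoc, Finset.prod_Icc_succ_top (by omega), ih, Finset.prod_range_succ, mul_assoc,
      ← pow_add, show n - 1 + d + 1 = n + d by omega]

theorem dim_twisted_jacquet_module {q n k : ℕ} (hq : IsPrimePow q)
    (F : Type*) [Field F] [Fintype F] (hF : Fintype.card F = q)
    (hn : 1 ≤ n) (hk : k ≤ n)
    (ψ₀ : AddChar F ℂˣ) (hψ₀ : ψ₀ ≠ 1)
    (V : Type*) [AddCommGroup V] [Module ℂ V] [FiniteDimensional ℂ V]
    (π : Representation ℂ ((Matrix (Fin n ⊕ Fin n) (Fin n ⊕ Fin n) F)ˣ) V)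
    (hΘ : ∀ X : Matrix (Fin n) (Fin n) F,
      LinearMap.trace ℂ V (π (uMat X)) =
        (-1 : ℂ) ^ (2 * n - 1) *
          ∏ i ∈ Finset.Icc 1 (2 * n - X.rank - 1), (1 - (q : ℂ) ^ i)) :
    (Module.finrank ℂ
        ↥(⨅ X : Matrix (Fin n) (Fin n) F,
          Module.End.eigenspace (π (uMat X))
            ((ψ₀ (Matrix.trace (Ak F n k * X)) : ℂˣ) : ℂ)) : ℂ) =
      (-1 : ℂ) ^ (n - 1) * (∏ i ∈ Finset.Icc 1 (n - 1), (1 - (q : ℂ) ^ i)) *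
        (q : ℂ) ^ (k * (k - 1) / 2) * ∏ j ∈ Finset.Ico k n, ((q : ℂ) ^ j - 1) := by
  classical
  subst hF
  set q : ℂ := (Fintype.card F : ℂ) with hq_def
  have hq0 : q ≠ 0 := Nat.cast_ne_zero.2 Fintype.card_ne_zero
  let : Fintype (Submodule F (Fin n → F)) := Fintype.ofFinite _
  set c : ℂ := ∏ i ∈ Icc 1 (n - 1), (1 - q ^ i)
  set A := Ak F n k with hA
  let χ : AddChar (Matrix (Fin n) (Fin n) F) ℂˣ :=
    { toFun X := ψ₀ (Matrix.trace (A * X))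
      map_zero_eq_one' := by simp
      map_add_eq_mul' X Y := by simp [mul_add, AddChar.map_add_eq_mul] }
  have htrace : ∀ X : Matrix (Fin n) (Fin n) F, LinearMap.trace ℂ V (π (uMat X)) =
      -c * ∑ W : Submodule F (Fin n → F) with W ≤ LinearMap.ker X.mulVecLin,
        (-q ^ n) ^ Module.finrank F W * q ^ (Module.finrank F W).choose 2 := by
    intro X
    have hrank : X.rank + Module.finrank F (LinearMap.ker X.mulVecLin) = n := by
      simpa [Matrix.rank] using X.mulVecLin.finrank_range_add_finrank_ker
    rw [hΘ, sum_submodule_le_eq_prod,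
      show 2 * n - X.rank - 1 = n - 1 + Module.finrank F (LinearMap.ker X.mulVecLin) by omega,
      prod_Icc_add ℂ q hn, Odd.neg_one_pow ⟨n - 1, by omega⟩]
    ring
  have hrange : Module.finrank F (LinearMap.range A.mulVecLin) = k := rank_Ak F hk
  have hcard : (Fintype.card (Matrix (Fin n) (Fin n) F) : ℂ) = q ^ (n * n) := by
    rw [Module.card_eq_pow_finrank (K := F), Module.finrank_matrix]
    simp [hq_def]
  have hmain : q ^ (n * n) * (Module.finrank ℂ
      ↥(⨅ X : Matrix (Fin n) (Fin n) F, Module.End.eigenspace (π (uMat X))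
        ((ψ₀ (Matrix.trace (A * X)) : ℂˣ) : ℂ)) : ℂ) =
      q ^ (n * n) * (-c * ((-1) ^ k * q ^ k.choose 2 * ∏ i ∈ Ico k n, (1 - q ^ i))) := by
    calc
      _ = ∑ X, ((χ (-X) : ℂˣ) : ℂ) * LinearMap.trace ℂ V (π (uMat X)) := by
        rw [← hcard]
        exact card_mul_finrank_iInf_eigenspace π (uMatHom F n) χ
      _ = ∑ X, ∑ W : Submodule F (Fin n → F) with W ≤ LinearMap.ker X.mulVecLin,
            -c * ((-q ^ n) ^ Module.finrank F W * q ^ (Module.finrank F W).choose 2) *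
              ((ψ₀ (Matrix.trace (-A * X)) : ℂˣ) : ℂ) := by
        refine Finset.sum_congr rfl fun X _ => ?_
        have hχ : χ (-X) = ψ₀ (Matrix.trace (-A * X)) := by
          rw [neg_mul_comm]
          rfl
        rw [htrace, hχ, Finset.mul_sum, Finset.mul_sum]
        exact Finset.sum_congr rfl fun W _ => by ring
      _ = ∑ W : Submodule F (Fin n → F),
            ∑ X : Matrix (Fin n) (Fin n) F with W ≤ LinearMap.ker X.mulVecLin,
            -c * ((-q ^ n) ^ Module.finrank F W * q ^ (Module.finrank F W).choose 2) *
              ((ψ₀ (Matrix.trace (-A * X)) : ℂˣ) : ℂ) :=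
        Finset.sum_comm' (by simp)
      _ = ∑ W : Submodule F (Fin n → F), if LinearMap.range A.mulVecLin ≤ W then
            q ^ (n * n) * (-c) *
              ((-1) ^ Module.finrank F W * q ^ (Module.finrank F W).choose 2) else 0 := by
        refine Finset.sum_congr rfl fun W _ => ?_
        have h := sum_addChar_trace_mul hψ₀ (-A) W
        have hneg : LinearMap.range (-A).mulVecLin = LinearMap.range A.mulVecLin := by
          rw [← LinearMap.range_neg A.mulVecLin]
          congr 1
          ext
          simp
        rw [hneg] at h
        rw [← Finset.mul_sum, neg_pow, ← pow_mul]
        calc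
          _ = -c * ((-1) ^ Module.finrank F W * q ^ (Module.finrank F W).choose 2) *
              (q ^ (n * Module.finrank F W) *
                ∑ X : Matrix (Fin n) (Fin n) F with W ≤ LinearMap.ker X.mulVecLin,
                  ((ψ₀ (Matrix.trace (-A * X)) : ℂˣ) : ℂ)) := by ring
          _ = _ := by
            rw [h]
            split_ifs <;> ring
      _ = _ := by
        rw [← Finset.sum_filter, ← Finset.mul_sum, sum_le_submodule_eq_prod, hrange]
        simp only [Module.finrank_fin_fun]
        ring
  have hsign : ∏ i ∈ Ico k n, (1 - q ^ i) = (-1) ^ (n - k) * ∏ i ∈ Ico k n, (q ^ i - 1) := by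
    rw [← Nat.card_Ico, ← Finset.prod_const, ← Finset.prod_mul_distrib]
    exact Finset.prod_congr rfl fun i _ => by ring
  rw [mul_left_cancel₀ (pow_ne_zero _ hq0) hmain, hsign, Nat.choose_two_right]
  have hpow : -((-1 : ℂ) ^ k * (-1) ^ (n - k)) = (-1) ^ (n - 1) := by
    obtain ⟨m, rfl⟩ := Nat.exists_eq_add_of_le' hn
    rw [← pow_add, Nat.add_sub_cancel' hk, Nat.add_sub_cancel, pow_succ]
    ring
  rw [← hpow]
  ring
end
end

section
/- Let q be a prime power, F a finite field with q elements, n ≥ 1, and 0 ≤ k ≤ n. Let ψ₀ : F → ℂ× be a nontrivial additive character and let A_k ∈ M(n,F) be the matrix with identity I_k in the upper-left k×k block and zeros elsewhere. Then Σ_{X ∈ M(n,F)} (∏_{i=1}^{2n - rank(X) - 1} (1 - q^i)) · ψ₀(tr(A_k X)) = (-1)^n · q^{n²} · (∏_{i=1}^{n-1}(1 - q^i)) · q^{k(k-1)/2} · ∏_{j=k}^{n-1}(q^j - 1). -/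
open Matrix Finset

noncomputable section

section SubspaceSums

open Classical Module

variable {F V : Type*} [Field F] [AddCommGroup V] [Module F V]

theorem covBy_sup_span_singleton {K H : Submodule F V} (hKH : K ⋖ H) {y : V} (hy : y ∈ H)
    (hyK : y ∉ K) : K ⊔ F ∙ y = H := by
  have h1 : K < K ⊔ F ∙ y :=
    left_lt_sup.2 fun h => hyK (h (Submodule.mem_span_singleton_self y))
  have h2 : K ⊔ F ∙ y ≤ H := sup_le hKH.le ((Submodule.span_singleton_le_iff_mem _ _).2 hy)
  exact h2.eq_of_not_lt (hKH.2 h1)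

theorem inf_sup_span_singleton_of_covBy {K H W : Submodule F V} (hKH : K ⋖ H) (hWH : W ≤ H)
    {y : V} (hy : y ∈ W) (hyK : y ∉ K) : W ⊓ K ⊔ F ∙ y = W := by
  rw [inf_sup_assoc_of_le _ ((Submodule.span_singleton_le_iff_mem _ _).2 hy),
    covBy_sup_span_singleton hKH (hWH hy) hyK, inf_eq_left.2 hWH]

theorem sup_span_singleton_inf_of_le {K U : Submodule F V} (hU : U ≤ K) {y : V} (hyK : y ∉ K) :
    (U ⊔ F ∙ y) ⊓ K = U := by
  rw [sup_inf_assoc_of_le _ hU, (Submodule.disjoint_span_singleton_of_notMem hyK).symm.eq_bot,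
    sup_bot_eq]

variable [Fintype F] [Fintype V]

theorem card_filter_mem_submodule (W : Submodule F V) :
    #{y : V | y ∈ W} = Fintype.card F ^ finrank F W := by
  rw [← Module.card_eq_pow_finrank (K := F) (V := W), Fintype.card_subtype]

theorem card_filter_mem_sdiff_submodule (W K : Submodule F V) :
    (#{y : V | y ∈ W ∧ y ∉ K} : ℂ) =
      (Fintype.card F : ℂ) ^ finrank F W - (Fintype.card F : ℂ) ^ finrank F ↥(W ⊓ K) := by
  have h := Finset.card_filter_add_card_filter_not (s := {y : V | y ∈ W}) (fun y => y ∈ K)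
  simp only [Finset.filter_filter, ← Submodule.mem_inf, card_filter_mem_submodule] at h
  rw [eq_sub_iff_add_eq', ← Nat.cast_pow, ← Nat.cast_pow, ← h, Nat.cast_add]

/-- The `q`-binomial theorem, as a sum over the subspaces in an interval. -/
theorem sum_submodule_Icc [Fintype (Submodule F V)] (x : ℂ) {R H : Submodule F V} (hRH : R ≤ H) :
    ∑ W : Submodule F V with R ≤ W ∧ W ≤ H,
        ∏ i ∈ range (finrank F W), (-(x * (Fintype.card F : ℂ) ^ i)) =
      (∏ i ∈ range (finrank F R), (-(x * (Fintype.card F : ℂ) ^ i))) *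
        ∏ i ∈ Ico (finrank F R) (finrank F H), (1 - x * (Fintype.card F : ℂ) ^ i) := by
  induction H using WellFoundedLT.induction with
  | ind H ih =>
  set q : ℂ := (Fintype.card F : ℂ) with hq
  have hq1 : q - 1 ≠ 0 := by
    rw [sub_ne_zero, hq]
    exact_mod_cast Fintype.one_lt_card.ne'
  obtain rfl | hlt := hRH.eq_or_lt
  · have : ({W | R ≤ W ∧ W ≤ R} : Finset (Submodule F V)) = {R} := by
      ext W
      simp [le_antisymm_iff, and_comm]
    simp [this]
  obtain ⟨K, hRK, hKH⟩ := exists_le_covBy_of_lt hlt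
  obtain ⟨y₀, hy₀, hy₀K⟩ := SetLike.exists_of_lt hKH.lt
  have hdH : finrank F H = finrank F K + 1 := by
    rw [← covBy_sup_span_singleton hKH hy₀ hy₀K, Submodule.finrank_sup_span_singleton hy₀K]
  have hdR : finrank F R ≤ finrank F K := Submodule.finrank_mono hRK
  have key : (q - 1) * ∑ W : Submodule F V with (R ≤ W ∧ W ≤ H) ∧ ¬ W ≤ K,
        ∏ i ∈ range (finrank F W), (-(x * q ^ i)) =
      (q - 1) * (-(x * q ^ finrank F K)) * ∑ W : Submodule F V with R ≤ W ∧ W ≤ K,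
        ∏ i ∈ range (finrank F W), (-(x * q ^ i)) := by
    calc _ = ∑ W : Submodule F V with (R ≤ W ∧ W ≤ H) ∧ ¬ W ≤ K, ∑ y : V with y ∈ W ∧ y ∉ K,
          -x * ∏ i ∈ range (finrank F ↥(W ⊓ K)), (-(x * q ^ i)) := by
          rw [mul_sum]
          refine sum_congr rfl fun W hW => ?_
          obtain ⟨⟨hRW, hWH⟩, hWK⟩ := (mem_filter.1 hW).2
          obtain ⟨y, hy, hyK⟩ := SetLike.not_le_iff_exists.1 hWK
          have hd : finrank F W = finrank F ↥(W ⊓ K) + 1 := by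
            conv_lhs => rw [← inf_sup_span_singleton_of_covBy hKH hWH hy hyK]
            exact Submodule.finrank_sup_span_singleton fun h => hyK h.2
          rw [sum_const, nsmul_eq_mul, card_filter_mem_sdiff_submodule, hd, prod_range_succ,
            ← hq]
          ring
      _ = ∑ y : V with y ∈ H ∧ y ∉ K, ∑ W : Submodule F V with R ≤ W ∧ W ≤ H ∧ y ∈ W,
          -x * ∏ i ∈ range (finrank F ↥(W ⊓ K)), (-(x * q ^ i)) := by
          refine sum_comm' fun W y => ?_
          simp only [mem_filter, mem_univ, true_and]
          constructor
          · rintro ⟨⟨⟨h1, h2⟩, -⟩, h3, h4⟩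
            exact ⟨⟨h1, h2, h3⟩, h2 h3, h4⟩
          · rintro ⟨⟨h1, h2, h3⟩, -, h4⟩
            exact ⟨⟨⟨h1, h2⟩, fun h => h4 (h h3)⟩, h3, h4⟩
      _ = ∑ y : V with y ∈ H ∧ y ∉ K, ∑ U : Submodule F V with R ≤ U ∧ U ≤ K,
          -x * ∏ i ∈ range (finrank F U), (-(x * q ^ i)) := by
          refine sum_congr rfl fun y hy => ?_
          obtain ⟨hyH, hyK⟩ := (mem_filter.1 hy).2
          refine sum_bij' (fun W _ => W ⊓ K) (fun U _ => U ⊔ F ∙ y) ?_ ?_ ?_ ?_ ?_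
          · intro W hW
            have hW := (mem_filter.1 hW).2
            exact mem_filter.2 ⟨mem_univ _, le_inf hW.1 hRK, inf_le_right⟩
          · intro U hU
            have hU := (mem_filter.1 hU).2
            exact mem_filter.2 ⟨mem_univ _, hU.1.trans le_sup_left,
              sup_le (hU.2.trans hKH.le) ((Submodule.span_singleton_le_iff_mem _ _).2 hyH),
              le_sup_right (a := U) (Submodule.mem_span_singleton_self y)⟩
          · intro W hW
            have hW := (mem_filter.1 hW).2
            exact inf_sup_span_singleton_of_covBy hKH hW.2.1 hW.2.2 hyK
          · intro U hU
            exact sup_span_singleton_inf_of_le (mem_filter.1 hU).2.2 hyK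
          · intro W _
            rfl
      _ = _ := by
          rw [sum_const, nsmul_eq_mul, card_filter_mem_sdiff_submodule, inf_eq_right.2 hKH.le,
            ← mul_sum, ← hq, hdH]
          ring
  rw [← sum_filter_add_sum_filter_not _ (fun W => W ≤ K), filter_filter, filter_filter]
  have hfilter : ({W | (R ≤ W ∧ W ≤ H) ∧ W ≤ K} : Finset (Submodule F V)) =
      ({W | R ≤ W ∧ W ≤ K} : Finset (Submodule F V)) := by
    ext W
    simp only [mem_filter, mem_univ, true_and]
    exact ⟨fun h => ⟨h.1.1, h.2⟩, fun h => ⟨⟨h.1, h.2.trans hKH.le⟩, h.2⟩⟩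
  rw [mul_assoc] at key
  rw [mul_left_cancel₀ hq1 key, hfilter, ih K hKH.lt hRK, hdH, prod_Ico_succ_top hdR]
  ring

/-- The sum of the character `f ↦ ψ (tr (T f))` over the endomorphisms vanishing on `W`. -/
theorem sum_addChar_linearMap (ψ : AddChar F ℂ) (hψ : ψ ≠ 0) (T : V →ₗ[F] V)
    [Fintype (V →ₗ[F] V)] (W : Submodule F V) :
    ∑ f : V →ₗ[F] V with W ≤ LinearMap.ker f, ψ (LinearMap.trace F V (T ∘ₗ f)) =
      if LinearMap.range T ≤ W then
        (Fintype.card F : ℂ) ^ (finrank F V * (finrank F V - finrank F W)) else 0 := by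
  have : Finite (V ⧸ W →ₗ[F] V) := Module.finite_of_finite F
  have := Fintype.ofFinite (V ⧸ W →ₗ[F] V)
  let χ : AddChar (V ⧸ W →ₗ[F] V) ℂ := ψ.compAddMonoidHom
    { toFun := fun g => LinearMap.trace F V (T ∘ₗ g ∘ₗ W.mkQ)
      map_zero' := by simp
      map_add' := fun g h => by simp [LinearMap.add_comp, LinearMap.comp_add] }
  have hsum : ∑ f : V →ₗ[F] V with W ≤ LinearMap.ker f, ψ (LinearMap.trace F V (T ∘ₗ f)) =
      ∑ g, χ g := by
    refine sum_bij' (fun f hf => W.liftQ f (mem_filter.1 hf).2) (fun g _ => g ∘ₗ W.mkQ)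
      (fun _ _ => mem_univ _) ?_ ?_ ?_ ?_
    · intro g _
      refine mem_filter.2 ⟨mem_univ _, fun w hw => ?_⟩
      simp [(Submodule.Quotient.mk_eq_zero W).2 hw]
    · intro f hf
      exact W.liftQ_mkQ f _
    · intro g _
      ext
      simp
    · intro f hf
      change _ = ψ (LinearMap.trace F V (T ∘ₗ W.liftQ f _ ∘ₗ W.mkQ))
      rw [W.liftQ_mkQ]
  have htriv : χ = 0 ↔ LinearMap.range T ≤ W := by
    constructor
    · intro hχ
      by_contra hT
      obtain ⟨_, ⟨v, rfl⟩, hv⟩ := SetLike.not_le_iff_exists.1 hT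
      obtain ⟨φ, hφv, hφ⟩ := Submodule.exists_le_ker_of_notMem hv
      obtain ⟨a, ha⟩ := AddChar.ne_one_iff.1 hψ
      apply ha
      have h := DFunLike.congr_fun hχ ((W.liftQ φ hφ).smulRight ((a / φ (T v)) • v))
      change ψ (LinearMap.trace F V (T ∘ₗ ((W.liftQ φ hφ).smulRight ((a / φ (T v)) • v)) ∘ₗ W.mkQ))
        = 1 at h
      have he : T ∘ₗ ((W.liftQ φ hφ).smulRight ((a / φ (T v)) • v)) ∘ₗ W.mkQ =
          φ.smulRight ((a / φ (T v)) • T v) := by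
        ext
        simp
      rwa [he, LinearMap.trace_smulRight, map_smul, smul_eq_mul, div_mul_cancel₀ _ hφv] at h
    · intro hT
      ext g
      change ψ (LinearMap.trace F V (T ∘ₗ g ∘ₗ W.mkQ)) = 1
      have h0 : W.mkQ ∘ₗ T = 0 := by
        rwa [← LinearMap.range_le_ker_iff, W.ker_mkQ]
      rw [LinearMap.trace_comp_comm', LinearMap.comp_assoc, h0, LinearMap.comp_zero, map_zero,
        ψ.map_zero_eq_one]
  have hcard : Fintype.card (V ⧸ W →ₗ[F] V) =
      Fintype.card F ^ (finrank F V * (finrank F V - finrank F W)) := by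
    rw [Module.card_eq_pow_finrank (K := F), Module.finrank_linearMap, Submodule.finrank_quotient,
      mul_comm]
  rw [hsum, AddChar.sum_eq_ite, hcard, Nat.cast_pow]
  simp only [htriv]

theorem sum_prod_mul_addChar [Fintype (V →ₗ[F] V)] (ψ : AddChar F ℂ) (hψ : ψ ≠ 0)
    (T : V →ₗ[F] V) :
    ∑ f : V →ₗ[F] V,
        (∏ i ∈ range (finrank F (LinearMap.ker f)),
          (1 - (Fintype.card F : ℂ) ^ finrank F V * (Fintype.card F : ℂ) ^ i)) *
        ψ (LinearMap.trace F V (T ∘ₗ f)) =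
      (Fintype.card F : ℂ) ^ (finrank F V ^ 2) *
        (∏ i ∈ range (finrank F (LinearMap.range T)), (-(Fintype.card F : ℂ) ^ i)) *
        ∏ i ∈ Ico (finrank F (LinearMap.range T)) (finrank F V),
          (1 - (Fintype.card F : ℂ) ^ i) := by
  have := Fintype.ofFinite (Submodule F V)
  set q : ℂ := (Fintype.card F : ℂ) with hq
  set n := finrank F V
  calc _ = ∑ f : V →ₗ[F] V, ∑ W : Submodule F V with W ≤ LinearMap.ker f,
        (∏ i ∈ range (finrank F W), (-(q ^ n * q ^ i))) *
          ψ (LinearMap.trace F V (T ∘ₗ f)) := by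
        refine sum_congr rfl fun f _ => ?_
        have h := sum_submodule_Icc (F := F) (q ^ n) (bot_le (a := LinearMap.ker f))
        simp only [bot_le, true_and, finrank_bot, range_zero, prod_empty, one_mul,
          Nat.Ico_zero_eq_range, ← hq] at h
        rw [← h, sum_mul]
    _ = ∑ W : Submodule F V, ∑ f : V →ₗ[F] V with W ≤ LinearMap.ker f,
        (∏ i ∈ range (finrank F W), (-(q ^ n * q ^ i))) *
          ψ (LinearMap.trace F V (T ∘ₗ f)) := sum_comm' (by simp)
    _ = ∑ W : Submodule F V with LinearMap.range T ≤ W ∧ W ≤ ⊤,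
        q ^ (n ^ 2) * ∏ i ∈ range (finrank F W), (-(1 * q ^ i)) := by
        simp only [le_top, and_true]
        rw [sum_filter]
        refine sum_congr rfl fun W _ => ?_
        rw [← mul_sum, sum_addChar_linearMap ψ hψ T W, mul_ite, mul_zero, ← hq]
        refine if_congr Iff.rfl ?_ rfl
        have hW : finrank F W ≤ n := Submodule.finrank_le W
        obtain ⟨m, hm⟩ := Nat.exists_eq_add_of_le hW
        simp only [neg_mul_eq_mul_neg, prod_mul_distrib, prod_const, card_range, one_mul]
        rw [show n * (n - finrank F W) = n * m by rw [hm, Nat.add_sub_cancel_left], mul_right_comm,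
          ← pow_mul, ← pow_add, ← mul_add, ← hm, sq]
    _ = _ := by
        rw [← mul_sum, sum_submodule_Icc 1 le_top, ← hq, finrank_top]
        simp only [one_mul, mul_assoc, n]

end SubspaceSums

theorem prod_Icc_one_add {M : Type*} [CommMonoid M] (f : ℕ → M) (m d : ℕ) :
    ∏ i ∈ Icc 1 (m + d), f i = (∏ i ∈ Icc 1 m, f i) * ∏ i ∈ range d, f (m + 1 + i) := by
  induction d with
  | zero => simp
  | succ d ih =>
    rw [← add_assoc, prod_Icc_succ_top (by omega), ih, prod_range_succ, mul_assoc,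
      add_right_comm]

theorem prod_range_neg_pow {R : Type*} [CommRing R] (x : R) (k : ℕ) :
    ∏ i ∈ range k, (-x ^ i) = (-1) ^ k * x ^ (k * (k - 1) / 2) := by
  rw [prod_neg, card_range, prod_pow_eq_pow_sum, sum_range_id]

theorem prod_Ico_one_sub_pow {R : Type*} [CommRing R] (x : R) (k n : ℕ) :
    ∏ i ∈ Ico k n, (1 - x ^ i) = (-1) ^ (n - k) * ∏ i ∈ Ico k n, (x ^ i - 1) := by
  rw [← Nat.card_Ico, ← prod_neg]
  simp only [neg_sub]

theorem finrank_range_toLin'_Ak (F : Type*) [Field F] {n k : ℕ} (hk : k ≤ n) :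
    Module.finrank F (LinearMap.range (Matrix.toLin' (Ak F n k))) = k := by
  classical
  have h : Ak F n k = Matrix.diagonal fun i : Fin n => if (i : ℕ) < k then 1 else 0 := by
    ext i j
    simp [Ak, Matrix.diagonal_apply, ite_and]
  change (Ak F n k).rank = k
  rw [h, Matrix.rank_diagonal]
  simp [Fintype.card_subtype, Fin.card_filter_val_lt, hk]

theorem character_sum_eval {q n k : ℕ} (hq : IsPrimePow q)
    (F : Type*) [Field F] [Fintype F] (hF : Fintype.card F = q)
    (hn : 1 ≤ n) (hk : k ≤ n)
    (ψ₀ : AddChar F ℂˣ) (hψ₀ : ψ₀ ≠ 1) :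
    ∑ X : Matrix (Fin n) (Fin n) F,
        (∏ i ∈ Finset.Icc 1 (2 * n - X.rank - 1), (1 - (q : ℂ) ^ i)) *
          ((ψ₀ (Matrix.trace (Ak F n k * X)) : ℂˣ) : ℂ) =
      (-1 : ℂ) ^ n * (q : ℂ) ^ (n ^ 2) *
        (∏ i ∈ Finset.Icc 1 (n - 1), (1 - (q : ℂ) ^ i)) *
        (q : ℂ) ^ (k * (k - 1) / 2) * ∏ j ∈ Finset.Ico k n, ((q : ℂ) ^ j - 1) := by
  classical
  subst hF
  let ψ : AddChar F ℂ := (Units.coeHom ℂ).compAddChar ψ₀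
  have hψ : ψ ≠ 0 := by
    obtain ⟨a, ha⟩ := AddChar.ne_one_iff.1 hψ₀
    exact AddChar.ne_one_iff.2 ⟨a, fun h => ha (Units.ext h)⟩
  have : Finite ((Fin n → F) →ₗ[F] (Fin n → F)) := Module.finite_of_finite F
  have := Fintype.ofFinite ((Fin n → F) →ₗ[F] (Fin n → F))
  have hmain := sum_prod_mul_addChar ψ hψ (Matrix.toLin' (Ak F n k))
  rw [finrank_range_toLin'_Ak F hk, Module.finrank_fin_fun] at hmain
  rw [prod_range_neg_pow, prod_Ico_one_sub_pow] at hmain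
  have hsum : ∑ X : Matrix (Fin n) (Fin n) F,
        (∏ i ∈ Finset.Icc 1 (2 * n - X.rank - 1), (1 - (Fintype.card F : ℂ) ^ i)) *
          ((ψ₀ (Matrix.trace (Ak F n k * X)) : ℂˣ) : ℂ) =
      (∏ i ∈ Finset.Icc 1 (n - 1), (1 - (Fintype.card F : ℂ) ^ i)) *
        ∑ f : (Fin n → F) →ₗ[F] (Fin n → F),
          (∏ i ∈ range (Module.finrank F (LinearMap.ker f)),
            (1 - (Fintype.card F : ℂ) ^ n * (Fintype.card F : ℂ) ^ i)) *
          ψ (LinearMap.trace F (Fin n → F) (Matrix.toLin' (Ak F n k) ∘ₗ f)) := by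
    rw [mul_sum]
    refine Fintype.sum_equiv Matrix.toLin'.toEquiv _ _ fun X => ?_
    have hker : X.rank + Module.finrank F (LinearMap.ker (Matrix.toLin' X)) = n := by
      have h := LinearMap.finrank_range_add_finrank_ker (Matrix.toLin' X)
      rwa [Module.finrank_fin_fun] at h
    rw [show 2 * n - X.rank - 1 =
        n - 1 + Module.finrank F (LinearMap.ker (Matrix.toLin' X)) by omega,
      prod_Icc_one_add, Nat.sub_add_cancel hn]
    simp only [LinearEquiv.coe_toEquiv, ← Matrix.toLin'_mul, Matrix.trace_toLin'_eq, mul_assoc,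
      pow_add]
    rfl
  rw [hsum, hmain]
  obtain ⟨m, rfl⟩ := Nat.exists_eq_add_of_le hk
  rw [Nat.add_sub_cancel_left, pow_add (-1 : ℂ) k m]
  ring
end
end

section
/- Let q be a prime power, F a finite field with q elements, n ≥ 1, and 0 ≤ k, r ≤ n. Let A_k ∈ M(n,F) be the matrix with identity I_k in the upper-left k×k block and zeros elsewhere, and for α ∈ F let f_{n,r,k}^α be the number of X ∈ M(n,F) with rank(X) = r and tr(A_k X) = α. Then f_{n,r,k}^0 - f_{n,r,k}^1 = Σ_{i=0}^{r} (-1)^i q^{i(i-1)/2 + k(r-i)} · [k choose i]_q · a(n-k, r-i, q), where a(m, s, q) is the number of m×m matrices over F of rank s (with a(m,s,q) = 0 when s > m, and a(0,0,q) = 1), and [k choose i]_q is the Gaussian binomial coefficient, equal to ∏_{j=0}^{i-1} (q^{k-j} - 1)/(q^{j+1} - 1) when 0 ≤ i ≤ k and 0 when i > k. -/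
open Matrix Finset

noncomputable section

/-- `fcount F n r k α` is the number of `n × n` matrices `X` over `F` with
`rank X = r` and `tr (A_k * X) = α`. -/
def fcount (F : Type*) [Field F] [Fintype F] (n r k : ℕ) (α : F) : ℕ :=
  Nat.card {X : Matrix (Fin n) (Fin n) F // X.rank = r ∧ Matrix.trace (Ak F n k * X) = α}

/-- `acount F m s` is the number of `m × m` matrices over `F` of rank `s`. -/
def acount (F : Type*) [Field F] [Fintype F] (m s : ℕ) : ℕ :=
  Nat.card {X : Matrix (Fin m) (Fin m) F // X.rank = s}

/-- The Gaussian (q-)binomial coefficient `[k choose i]_q`, equal to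
`∏_{j=0}^{i-1} (q^{k-j} - 1)/(q^{j+1} - 1)` for `i ≤ k`, and `0` for `i > k`. -/
def qBinom (q : ℚ) (k i : ℕ) : ℚ :=
  if i ≤ k then ∏ j ∈ Finset.range i, (q ^ (k - j) - 1) / (q ^ (j + 1) - 1) else 0

/-! ### Gaussian binomial coefficients -/

theorem qBinom_eq_prod (q : ℚ) (k i : ℕ) :
    qBinom q k i = ∏ j ∈ Finset.range i, (q ^ (k - j) - 1) / (q ^ (j + 1) - 1) := by
  unfold qBinom
  split_ifs with h
  · rfl
  · exact (Finset.prod_eq_zero (Finset.mem_range.2 (not_le.1 h)) (by simp)).symm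

theorem qBinom_zero_right (q : ℚ) (k : ℕ) : qBinom q k 0 = 1 := by
  simp [qBinom]

theorem qBinom_zero_succ (q : ℚ) (i : ℕ) : qBinom q 0 (i + 1) = 0 := by
  simp [qBinom]

theorem qBinom_succ_right (q : ℚ) (k i : ℕ) :
    qBinom q k (i + 1) = qBinom q k i * ((q ^ (k - i) - 1) / (q ^ (i + 1) - 1)) := by
  simp only [qBinom_eq_prod, Finset.prod_range_succ]

theorem qBinom_succ_succ_eq_mul {q : ℚ} (hq : 1 < q) (k i : ℕ) :
    qBinom q (k + 1) (i + 1) = (q ^ (k + 1) - 1) / (q ^ (i + 1) - 1) * qBinom q k i := by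
  have h (m : ℕ) : q ^ (m + 1) - 1 ≠ 0 := (sub_pos.2 (one_lt_pow₀ hq m.succ_ne_zero)).ne'
  induction i with
  | zero => simp [qBinom_succ_right, qBinom_zero_right]
  | succ i ih =>
    rw [qBinom_succ_right q (k + 1) (i + 1), ih, qBinom_succ_right q k i, Nat.add_sub_add_right]
    have h1 := h i
    have h2 := h (i + 1)
    field_simp

theorem qBinom_succ_succ {q : ℚ} (hq : 1 < q) (k i : ℕ) :
    qBinom q (k + 1) (i + 1) = q ^ (i + 1) * qBinom q k (i + 1) + qBinom q k i := by
  have h : q ^ (i + 1) - 1 ≠ 0 := (sub_pos.2 (one_lt_pow₀ hq i.succ_ne_zero)).ne'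
  rw [qBinom_succ_succ_eq_mul hq, qBinom_succ_right]
  by_cases hik : i ≤ k
  · obtain ⟨d, rfl⟩ := Nat.exists_eq_add_of_le hik
    rw [Nat.add_sub_cancel_left]
    field_simp
    ring
  · simp [qBinom, hik]

/-- The alternating sum of a sequence `a` against Gaussian binomial coefficients. -/
def qAltSum (q : ℚ) (a : ℕ → ℚ) (k r : ℕ) : ℚ :=
  ∑ i ∈ Finset.range (r + 1),
    (-1 : ℚ) ^ i * q ^ (i * (i - 1) / 2 + k * (r - i)) * qBinom q k i * a (r - i)

theorem qAltSum_zero_left (q : ℚ) (a : ℕ → ℚ) (r : ℕ) : qAltSum q a 0 r = a r := by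
  simp [qAltSum, Finset.sum_range_succ', qBinom_zero_right, qBinom_zero_succ]

theorem qAltSum_zero_right (q : ℚ) (a : ℕ → ℚ) (k : ℕ) : qAltSum q a k 0 = a 0 := by
  simp [qAltSum, qBinom_zero_right]

theorem qAltSum_succ_succ {q : ℚ} (hq : 1 < q) (a : ℕ → ℚ) (k r : ℕ) :
    qAltSum q a (k + 1) (r + 1) = q ^ (r + 1) * qAltSum q a k (r + 1) - q ^ r * qAltSum q a k r := by
  unfold qAltSum
  rw [Finset.sum_range_succ' _ (r + 1), Finset.sum_range_succ' _ (r + 1), mul_add, Finset.mul_sum,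
    Finset.mul_sum, add_sub_right_comm, ← Finset.sum_sub_distrib]
  congr 1
  · refine Finset.sum_congr rfl fun i hi => ?_
    obtain ⟨d, rfl⟩ := Nat.exists_eq_add_of_le (Nat.lt_succ_iff.1 (Finset.mem_range.1 hi))
    rw [qBinom_succ_succ hq, Nat.triangle_succ, Nat.add_sub_add_right, Nat.add_sub_cancel_left]
    ring
  · simp only [qBinom_zero_right, tsub_zero]
    ring

section

/-! ### Trace and row span -/

variable {F : Type*} [Field F]

theorem trace_Ak_mul (n k : ℕ) (X : Matrix (Fin n) (Fin n) F) :
    trace (Ak F n k * X) = ∑ i : Fin n, if (i : ℕ) < k then X i i else 0 := by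
  simp [trace, Matrix.mul_apply, Ak, ite_and]

/-- Prepending a zero coordinate to each row does not change the dimension of the row span. -/
theorem finrank_span_range_cons_zero {n m : ℕ} (Z : Matrix (Fin m) (Fin n) F) :
    Module.finrank F (Submodule.span F
      (Set.range fun i => (Fin.cons 0 (Z i) : Fin (n + 1) → F))) = Z.rank := by
  let e : (Fin n → F) →ₗ[F] (Fin (n + 1) → F) :=
    { toFun := fun v => Fin.cons 0 v
      map_add' := fun u v => by
        funext i
        refine Fin.cases ?_ (fun j => ?_) i <;> simp
      map_smul' := fun a v => by
        funext i
        refine Fin.cases ?_ (fun j => ?_) i <;> simp }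
  have he : Function.Injective e := fun u v h => by
    funext i
    simpa [e] using congrFun h i.succ
  have hr : (Set.range fun i => (Fin.cons 0 (Z i) : Fin (n + 1) → F)) = e '' Set.range Z :=
    Set.range_comp e Z
  rw [hr, Submodule.span_image, ← (Submodule.equivMapOfInjective e he _).finrank_eq,
    Matrix.rank_eq_finrank_span_row]
  rfl

/-! ### Sums over vector spaces -/

variable [Fintype F]

theorem sum_comp_linearMap_add {V : Type*} [AddCommGroup V] [Module F V] [Fintype V]
    {w : F → ℚ} (hw : ∑ a, w a = 0) (φ : V →ₗ[F] F) (c : F) [Decidable (φ = 0)] :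
    ∑ v, w (φ v + c) = if φ = 0 then (Fintype.card V : ℚ) * w c else 0 := by
  classical
  split_ifs with h
  · simp [h]
  · obtain ⟨v₀, hv₀⟩ : ∃ v, φ v ≠ 0 := by
      by_contra! H
      exact h (LinearMap.ext H)
    have key (a : F) : ∑ v, w (φ v + c) = ∑ v, w (φ v + a) := by
      refine Fintype.sum_equiv (Equiv.addRight (((c - a) / φ v₀) • v₀)) _ _ fun v => ?_
      simp [hv₀]
      congr 1
      ring
    have h2 : (Fintype.card F : ℚ) * ∑ v, w (φ v + c) = 0 := by
      calc (Fintype.card F : ℚ) * ∑ v, w (φ v + c) = ∑ _a : F, ∑ v, w (φ v + c) := by simp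
        _ = ∑ a : F, ∑ v, w (φ v + a) := Finset.sum_congr rfl fun a _ => key a
        _ = ∑ v, ∑ a : F, w (φ v + a) := Finset.sum_comm
        _ = ∑ _v : V, (0 : ℚ) := Finset.sum_congr rfl fun v _ => by
            rw [← hw]
            exact Fintype.sum_equiv (Equiv.addLeft (φ v)) _ _ fun a => rfl
        _ = 0 := by simp
    exact (mul_eq_zero.1 h2).resolve_left (by simp)

open Classical in
theorem sum_finrank_span_insert {V : Type*} [AddCommGroup V] [Module F V] [Fintype V]
    {w : F → ℚ} (hw : ∑ a, w a = 0) {φ : V →ₗ[F] F} (hφ : φ ≠ 0) (c : F) (s : Set V) (r : ℕ) :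
    ∑ x, (if Module.finrank F (Submodule.span F (insert x s)) = r then w (φ x + c) else 0) =
      if s ⊆ (LinearMap.ker φ : Set V) then
        ((if Module.finrank F (Submodule.span F s) = r then 1 else 0) -
          (if Module.finrank F (Submodule.span F s) + 1 = r then 1 else 0)) *
          (Fintype.card F : ℚ) ^ Module.finrank F (Submodule.span F s) * w c
      else 0 := by
  set C := Submodule.span F s with hC
  set d := Module.finrank F C with hd
  have hin (x : V) (hx : x ∈ C) : Module.finrank F (Submodule.span F (insert x s)) = d := by
    rw [Submodule.span_insert_eq_span hx]
  have hout (x : V) (hx : x ∉ C) :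
      Module.finrank F (Submodule.span F (insert x s)) = d + 1 := by
    rw [Submodule.span_insert, sup_comm]
    exact Submodule.finrank_sup_span_singleton hx
  have hpt (x : V) :
      (if Module.finrank F (Submodule.span F (insert x s)) = r then w (φ x + c) else 0) =
        ((if d = r then 1 else 0) - (if d + 1 = r then 1 else 0)) *
          (if x ∈ C then w (φ x + c) else 0) + (if d + 1 = r then 1 else 0) * w (φ x + c) := by
    by_cases hx : x ∈ C
    · simp only [hin x hx, hx, if_true]
      split_ifs <;> ring
    · simp only [hout x hx, hx, if_false]
      split_ifs <;> ring
  have hsub : ∑ x, (if x ∈ C then w (φ x + c) else 0) =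
      if s ⊆ (LinearMap.ker φ : Set V) then (Fintype.card F : ℚ) ^ d * w c else 0 := by
    have h1 : ∑ x, (if x ∈ C then w (φ x + c) else 0) = ∑ x : C, w (φ.domRestrict C x + c) := by
      rw [← Finset.sum_filter]
      exact Finset.sum_subtype _ (by simp) _
    have h2 : φ.domRestrict C = 0 ↔ s ⊆ (LinearMap.ker φ : Set V) := by
      rw [← Submodule.span_le, ← hC]
      constructor
      · intro h x hx
        exact DFunLike.congr_fun h ⟨x, hx⟩
      · intro h
        ext x
        exact h x.2
    rw [h1, sum_comp_linearMap_add hw, Module.card_eq_pow_finrank (K := F) (V := C)]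
    simp only [h2, Nat.cast_pow, hd]
  rw [Finset.sum_congr rfl fun x _ => hpt x, Finset.sum_add_distrib, ← Finset.mul_sum,
    ← Finset.mul_sum, hsub, sum_comp_linearMap_add hw, if_neg hφ]
  split_ifs <;> ring

/-! ### Weighted sums over matrices of given rank -/

open Classical in
/-- The sum of `w (tr (A_k * X))` over the `n × n` matrices `X` of rank `r`. -/
def rankSum (w : F → ℚ) (n k r : ℕ) : ℚ :=
  ∑ X : Matrix (Fin n) (Fin n) F, if X.rank = r then w (trace (Ak F n k * X)) else 0

theorem rankSum_zero (w : F → ℚ) (n r : ℕ) : rankSum w n 0 r = w 0 * acount F n r := by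
  classical
  unfold rankSum acount
  simp only [trace_Ak_mul, not_lt_zero, if_false, Finset.sum_const_zero]
  rw [Nat.card_eq_fintype_card, Fintype.card_subtype, ← Finset.sum_filter, Finset.sum_const,
    nsmul_eq_mul, mul_comm]

open Classical in
theorem rankSum_succ_succ {w : F → ℚ} (hw : ∑ a, w a = 0) (n k r : ℕ) :
    rankSum w (n + 1) (k + 1) r =
      ∑ Z : Matrix (Fin n) (Fin n) F,
        ((if Z.rank = r then 1 else 0) - (if Z.rank + 1 = r then 1 else 0)) *
          (Fintype.card F : ℚ) ^ Z.rank * w (trace (Ak F n k * Z)) := by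
  let φ : (Fin (n + 1) → F) →ₗ[F] F := LinearMap.proj 0
  have hφ : φ ≠ 0 := fun h => one_ne_zero (α := F) (by
    simpa [φ] using DFunLike.congr_fun h (fun _ => (1 : F)))
  have h1 : rankSum w (n + 1) (k + 1) r =
      ∑ Y : Fin n → Fin (n + 1) → F, ∑ x : Fin (n + 1) → F,
        if Module.finrank F (Submodule.span F (insert x (Set.range Y))) = r then
          w (φ x + ∑ i : Fin n, if (i : ℕ) < k then Y i i.succ else 0) else 0 := by
    unfold rankSum
    rw [← Fintype.sum_prod_type_right']
    refine (Fintype.sum_equiv (Fin.consEquiv fun _ : Fin (n + 1) => Fin (n + 1) → F) _ _ ?_).symm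
    rintro ⟨x, Y⟩
    let X : Matrix (Fin (n + 1)) (Fin (n + 1)) F := Matrix.of (Fin.cons x Y)
    change _ = if X.rank = r then w (trace (Ak F (n + 1) (k + 1) * X)) else 0
    have hX : Set.range X.row = insert x (Set.range Y) := Fin.range_cons x Y
    rw [trace_Ak_mul, Fin.sum_univ_succ, Matrix.rank_eq_finrank_span_row, hX]
    simp [X, φ]
  rw [h1, Finset.sum_congr rfl fun Y _ => sum_finrank_span_insert hw hφ _ (Set.range Y) r,
    ← Finset.sum_filter]
  refine (Finset.sum_bij
    (fun (Z : Matrix (Fin n) (Fin n) F) _ => fun i => (Fin.cons 0 (Z i) : Fin (n + 1) → F))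
    ?_ ?_ ?_ ?_).symm
  · rintro Z -
    simp [Set.range_subset_iff, φ]
  · intro Z _ Z' _ h
    funext i
    exact (Fin.cons_injective2 (congrFun h i)).2
  · intro Y hY
    simp only [Finset.mem_filter, Finset.mem_univ, true_and, Set.range_subset_iff] at hY
    refine ⟨fun i => Fin.tail (Y i), Finset.mem_univ _, ?_⟩
    funext i
    have h0 : Y i 0 = 0 := hY i
    exact h0 ▸ Fin.cons_self_tail (Y i)
  · rintro Z -
    rw [finrank_span_range_cons_zero, trace_Ak_mul]
    simp

theorem rankSum_succ_succ_zero {w : F → ℚ} (hw : ∑ a, w a = 0) (n k : ℕ) :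
    rankSum w (n + 1) (k + 1) 0 = rankSum w n k 0 := by
  rw [rankSum_succ_succ hw, rankSum]
  refine Finset.sum_congr rfl fun Z _ => ?_
  by_cases h : Z.rank = 0 <;> simp [h]

theorem rankSum_succ_succ_succ {w : F → ℚ} (hw : ∑ a, w a = 0) (n k r : ℕ) :
    rankSum w (n + 1) (k + 1) (r + 1) =
      (Fintype.card F : ℚ) ^ (r + 1) * rankSum w n k (r + 1) -
        (Fintype.card F : ℚ) ^ r * rankSum w n k r := by
  rw [rankSum_succ_succ hw, rankSum, rankSum, Finset.mul_sum, Finset.mul_sum,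
    ← Finset.sum_sub_distrib]
  refine Finset.sum_congr rfl fun Z _ => ?_
  by_cases h : Z.rank = r + 1
  · simp [h]
  · by_cases h' : Z.rank = r <;> simp [h, h']

theorem rankSum_add_eq {w : F → ℚ} (hw : ∑ a, w a = 0) (m k r : ℕ) :
    rankSum w (m + k) k r =
      w 0 * qAltSum (Fintype.card F) (fun s => (acount F m s : ℚ)) k r := by
  have hq : (1 : ℚ) < Fintype.card F := by exact_mod_cast Fintype.one_lt_card
  induction k generalizing r with
  | zero => rw [qAltSum_zero_left, add_zero, rankSum_zero]
  | succ k ih =>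
    rw [← add_assoc]
    cases r with
    | zero => rw [rankSum_succ_succ_zero hw, ih, qAltSum_zero_right, qAltSum_zero_right]
    | succ r =>
      rw [rankSum_succ_succ_succ hw, ih, ih, qAltSum_succ_succ hq]
      ring

open Classical in
theorem fcount_eq_rankSum (n r k : ℕ) (α : F) :
    (fcount F n r k α : ℚ) =
      ∑ X : Matrix (Fin n) (Fin n) F,
        if X.rank = r then (if trace (Ak F n k * X) = α then 1 else 0) else 0 := by
  rw [fcount, Nat.card_eq_fintype_card, Fintype.card_subtype]
  simp [← ite_and]

open Classical in
theorem fcount_sub_fcount (n r k : ℕ) (α β : F) :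
    (fcount F n r k α : ℚ) - fcount F n r k β =
      rankSum (fun a => (if a = α then 1 else 0) - (if a = β then 1 else 0)) n k r := by
  rw [fcount_eq_rankSum, fcount_eq_rankSum, ← Finset.sum_sub_distrib, rankSum]
  refine Finset.sum_congr rfl fun X _ => ?_
  by_cases h : X.rank = r <;> simp [h]

end

theorem f_zero_sub_f_one {q n k r : ℕ} (hq : IsPrimePow q)
    (F : Type*) [Field F] [Fintype F] (hF : Fintype.card F = q)
    (hn : 1 ≤ n) (hk : k ≤ n) (hr : r ≤ n) :
    (fcount F n r k 0 : ℚ) - (fcount F n r k 1 : ℚ) =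
      ∑ i ∈ Finset.range (r + 1),
        (-1 : ℚ) ^ i * (q : ℚ) ^ (i * (i - 1) / 2 + k * (r - i)) *
          qBinom (q : ℚ) k i * (acount F (n - k) (r - i) : ℚ) := by
  classical
  subst hF
  obtain ⟨m, rfl⟩ := Nat.exists_eq_add_of_le' hk
  rw [fcount_sub_fcount, rankSum_add_eq (by simp), Nat.add_sub_cancel]
  simp [qAltSum]
end
end

section
/- Let q be a prime power and F the finite field with q elements. Let n be a nonnegative integer and t an integer with t ≥ 2n. Then Σ_{r=0}^{n} a(n,r,q) · (q;q)_{t-r} = q^{n²} · (q;q)_{t-n}² / (q;q)_{t-2n}, where a(n,r,q) is the number of n×n matrices over F of rank r and (x;q)_m = ∏_{i=0}^{m-1}(1 - x q^i) is the q-Pochhammer symbol (the identity may equivalently be stated in product form as Σ_{r=0}^{n} a(n,r,q) · (q;q)_{t-r} · (q;q)_{t-2n} = q^{n²} · (q;q)_{t-n}²). -/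
open Matrix Finset

noncomputable section

/-- The q-Pochhammer symbol `(x; q)_m = ∏_{i=0}^{m-1} (1 - x q^i)`. -/
def qPoch (q x : ℚ) (m : ℕ) : ℚ :=
  ∏ i ∈ Finset.range m, (1 - x * q ^ i)

/-- Splitting off the last factor of `(q; q)_(m+1)`. -/
lemma qPoch_self_succ (q : ℚ) (m : ℕ) :
    qPoch q q (m + 1) = qPoch q q m * (1 - q ^ (m + 1)) := by
  rw [qPoch, qPoch, Finset.prod_range_succ, pow_succ' q m]

lemma qPoch_self_ne_zero {q : ℚ} (hq : 1 < q) (m : ℕ) : qPoch q q m ≠ 0 := by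
  refine Finset.prod_ne_zero_iff.2 fun i _ ↦ ?_
  rw [← pow_succ', sub_ne_zero]
  exact (one_lt_pow₀ hq i.succ_ne_zero).ne

/-- Summing a function of `dim (W + ⟨x⟩)` over all vectors `x`. -/
lemma sum_finrank_span_singleton_sup {F V : Type*} [Field F] [Fintype F] [AddCommGroup V]
    [Module F V] [Fintype V] (W : Submodule F V) (f : ℕ → ℚ) :
    ∑ x : V, f (Module.finrank F ↥(Submodule.span F {x} ⊔ W)) =
      (Fintype.card F : ℚ) ^ Module.finrank F W * f (Module.finrank F W) +
        ((Fintype.card F : ℚ) ^ Module.finrank F V - (Fintype.card F : ℚ) ^ Module.finrank F W) *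
          f (Module.finrank F W + 1) := by
  classical
  have hrank (x : V) : f (Module.finrank F ↥(Submodule.span F {x} ⊔ W)) =
      f (Module.finrank F W + 1) +
        if x ∈ W then f (Module.finrank F W) - f (Module.finrank F W + 1) else 0 := by
    split_ifs with hx
    · rw [sup_eq_right.2 ((Submodule.span_singleton_le_iff_mem x W).2 hx)]
      ring
    · rw [sup_comm, Submodule.finrank_sup_span_singleton hx, add_zero]
  have hW : (#{x : V | x ∈ W} : ℚ) = (Fintype.card F : ℚ) ^ Module.finrank F W := by
    rw [← Fintype.card_subtype]
    exact_mod_cast Module.card_eq_pow_finrank (K := F) (V := W)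
  have hV : (Fintype.card V : ℚ) = (Fintype.card F : ℚ) ^ Module.finrank F V := by
    exact_mod_cast Module.card_eq_pow_finrank (K := F) (V := V)
  simp_rw [hrank]
  rw [Finset.sum_add_distrib, ← Finset.sum_filter, Finset.sum_const, Finset.sum_const,
    nsmul_eq_mul, nsmul_eq_mul, hW, Finset.card_univ, hV]
  ring

/-- Summing a function of the rank over all `(n + 1)`-tuples of vectors, in terms of `n`-tuples. -/
lemma sum_finrank_span_range_succ {F V : Type*} [Field F] [Fintype F] [AddCommGroup V]
    [Module F V] [Fintype V] (n : ℕ) (f : ℕ → ℚ) :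
    ∑ v : Fin (n + 1) → V, f (Module.finrank F (Submodule.span F (Set.range v))) =
      ∑ v : Fin n → V,
        ((Fintype.card F : ℚ) ^ Module.finrank F (Submodule.span F (Set.range v)) *
            f (Module.finrank F (Submodule.span F (Set.range v))) +
          ((Fintype.card F : ℚ) ^ Module.finrank F V -
              (Fintype.card F : ℚ) ^ Module.finrank F (Submodule.span F (Set.range v))) *
            f (Module.finrank F (Submodule.span F (Set.range v)) + 1)) := by
  rw [← (Fin.consEquiv fun _ : Fin (n + 1) ↦ V).sum_comp, Fintype.sum_prod_type_right]
  refine Finset.sum_congr rfl fun v _ ↦ ?_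
  rw [← sum_finrank_span_singleton_sup]
  refine Finset.sum_congr rfl fun x _ ↦ ?_
  rw [← Submodule.span_union, Set.singleton_union, ← Fin.range_cons]
  rfl

/-- The rectangular form of the identity, summed over `n`-tuples of vectors. -/
lemma sum_qPoch_finrank_span_range {F V : Type*} [Field F] [Fintype F] [AddCommGroup V]
    [Module F V] [Fintype V] (n t : ℕ) (ht : Module.finrank F V + n ≤ t) :
    (∑ v : Fin n → V, qPoch (Fintype.card F) (Fintype.card F)
        (t - Module.finrank F (Submodule.span F (Set.range v)))) *
      qPoch (Fintype.card F) (Fintype.card F) (t - Module.finrank F V - n) =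
    (Fintype.card F : ℚ) ^ (Module.finrank F V * n) *
      qPoch (Fintype.card F) (Fintype.card F) (t - Module.finrank F V) *
      qPoch (Fintype.card F) (Fintype.card F) (t - n) := by
  induction n generalizing t with
  | zero =>
    have hzero (v : Fin 0 → V) : Module.finrank F (Submodule.span F (Set.range v)) = 0 := by
      rw [Set.range_eq_empty, Submodule.span_empty, finrank_bot]
    simp only [hzero]
    simp [mul_comm]
  | succ n ih =>
    obtain ⟨d, rfl⟩ := Nat.exists_eq_add_of_le ht
    set q : ℚ := (Fintype.card F : ℚ)
    set m := Module.finrank F V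
    have hstep (v : Fin n → V) :
        q ^ Module.finrank F (Submodule.span F (Set.range v)) *
            qPoch q q (m + (n + 1) + d - Module.finrank F (Submodule.span F (Set.range v))) +
          (q ^ m - q ^ Module.finrank F (Submodule.span F (Set.range v))) *
            qPoch q q
              (m + (n + 1) + d - (Module.finrank F (Submodule.span F (Set.range v)) + 1)) =
        (q ^ m - q ^ (m + (n + 1) + d)) *
          qPoch q q (m + n + d - Module.finrank F (Submodule.span F (Set.range v))) := by
      have hr : Module.finrank F (Submodule.span F (Set.range v)) ≤ n := by
        simpa [Set.finrank] using finrank_range_le_card (R := F) v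
      generalize Module.finrank F (Submodule.span F (Set.range v)) = r at hr ⊢
      obtain ⟨e, rfl⟩ := Nat.exists_eq_add_of_le hr
      rw [show m + (r + e + 1) + d - r = m + e + d + 1 by omega,
        show m + (r + e + 1) + d - (r + 1) = m + e + d by omega,
        show m + (r + e) + d - r = m + e + d by omega, qPoch_self_succ]
      ring
    have hsum := (sum_finrank_span_range_succ (F := F) (V := V) n
      fun r ↦ qPoch q q (m + (n + 1) + d - r)).trans
        ((Finset.sum_congr rfl fun v _ ↦ hstep v).trans (Finset.mul_sum ..).symm)
    rw [hsum]
    have h := ih (m + n + d) (by omega)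
    rw [show m + n + d - m - n = d by omega, show m + n + d - m = n + d by omega,
      show m + n + d - n = m + d by omega] at h
    rw [show m + (n + 1) + d - m - (n + 1) = d by omega,
      show m + (n + 1) + d - m = n + d + 1 by omega,
      show m + (n + 1) + d - (n + 1) = m + d by omega, mul_assoc, h, qPoch_self_succ]
    ring

/-- Summing over matrices by rank. -/
lemma sum_acount_mul (F : Type*) [Field F] [Fintype F] (n : ℕ) (f : ℕ → ℚ) :
    ∑ r ∈ Finset.range (n + 1), (acount F n r : ℚ) * f r =
      ∑ v : Fin n → Fin n → F, f (Module.finrank F (Submodule.span F (Set.range v))) := by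
  classical
  have hmem (X : Matrix (Fin n) (Fin n) F) : X.rank ∈ Finset.range (n + 1) := by
    simpa [Nat.lt_succ_iff] using X.rank_le_height
  have hsum := Finset.sum_fiberwise_of_maps_to
    (s := (Finset.univ : Finset (Matrix (Fin n) (Fin n) F))) (fun X _ ↦ hmem X)
    fun X ↦ f X.rank
  have hrow : ∑ v : Fin n → Fin n → F, f (Module.finrank F (Submodule.span F (Set.range v))) =
      ∑ X : Matrix (Fin n) (Fin n) F, f X.rank :=
    Fintype.sum_equiv Matrix.of _ _ fun v ↦ by rw [Matrix.rank_eq_finrank_span_row]; rfl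
  rw [hrow, ← hsum]
  refine Finset.sum_congr rfl fun r _ ↦ ?_
  rw [Finset.sum_congr rfl fun X hX ↦ by rw [(Finset.mem_filter.1 hX).2], Finset.sum_const,
    nsmul_eq_mul, acount, Nat.card_eq_fintype_card, Fintype.card_subtype]

theorem rank_count_qPoch_sum {q : ℕ} (hq : IsPrimePow q)
    (F : Type*) [Field F] [Fintype F] (hF : Fintype.card F = q)
    (n t : ℕ) (ht : 2 * n ≤ t) :
    ∑ r ∈ Finset.range (n + 1), (acount F n r : ℚ) * qPoch (q : ℚ) (q : ℚ) (t - r) =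
      (q : ℚ) ^ (n ^ 2) * (qPoch (q : ℚ) (q : ℚ) (t - n)) ^ 2 /
        qPoch (q : ℚ) (q : ℚ) (t - 2 * n) := by
  subst hF
  have hF1 : (1 : ℚ) < Fintype.card F := by exact_mod_cast hq.one_lt
  have h := sum_qPoch_finrank_span_range (F := F) (V := Fin n → F) n t
    (by rw [Module.finrank_fin_fun]; omega)
  rw [Module.finrank_fin_fun, Nat.sub_sub, ← two_mul] at h
  rw [sum_acount_mul F n fun r ↦ qPoch (Fintype.card F) (Fintype.card F) (t - r),
    eq_div_iff (qPoch_self_ne_zero hF1 _), h]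
  ring
end
end

section
/- Let q be a prime power, F the finite field with q elements, and 0 ≤ k ≤ n integers. Then the number a(n,k,q) of n×n matrices over F of rank k satisfies a(n,k,q) = (-1)^k · (q^{-n};q)_k² · q^{2nk - k(k-1)/2} / (q;q)_k, where (x;q)_m = ∏_{i=0}^{m-1}(1 - x q^i) is the q-Pochhammer symbol and the identity is read in the field of rational numbers (q^{-n} = 1/q^n). -/
open Matrix Finset

noncomputable section

namespace Matrix

section RankFactorization

variable {F : Type*} [Field F] {m n k : ℕ}

lemma exists_right_inverse_of_rank_eq_height {B : Matrix (Fin k) (Fin n) F} (hB : B.rank = k) :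
    ∃ D : Matrix (Fin n) (Fin k) F, B * D = 1 := by
  rw [← mulVec_surjective_iff_exists_right_inverse]
  have h : LinearMap.range B.mulVecLin = ⊤ := by
    apply Submodule.eq_top_of_finrank_eq
    simpa [Matrix.rank] using hB
  exact LinearMap.range_eq_top.mp h

lemma exists_left_inverse_of_rank_eq_width {A : Matrix (Fin m) (Fin k) F} (hA : A.rank = k) :
    ∃ C : Matrix (Fin k) (Fin m) F, C * A = 1 := by
  obtain ⟨D, hD⟩ := exists_right_inverse_of_rank_eq_height (B := Aᵀ) (by rw [rank_transpose, hA])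
  exact ⟨Dᵀ, by rw [← transpose_inj, transpose_mul, transpose_transpose, hD, transpose_one]⟩

lemma rank_mul_eq_of_rank_eq_inner {A : Matrix (Fin m) (Fin k) F} {B : Matrix (Fin k) (Fin n) F}
    (hA : A.rank = k) (hB : B.rank = k) : (A * B).rank = k := by
  obtain ⟨C, hC⟩ := exists_left_inverse_of_rank_eq_width hA
  refine le_antisymm ((rank_mul_le_left A B).trans hA.le) ?_
  calc k = B.rank := hB.symm
    _ = (C * (A * B)).rank := by rw [← Matrix.mul_assoc, hC, Matrix.one_mul]
    _ ≤ (A * B).rank := rank_mul_le_right _ _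

lemma exists_rank_factorization {X : Matrix (Fin m) (Fin n) F} (hX : X.rank = k) :
    ∃ (A : Matrix (Fin m) (Fin k) F) (B : Matrix (Fin k) (Fin n) F),
      A.rank = k ∧ B.rank = k ∧ A * B = X := by
  let b := Module.finBasisOfFinrankEq F (LinearMap.range X.mulVecLin) hX
  let c (l : Fin n) : LinearMap.range X.mulVecLin := ⟨X.mulVecLin (Pi.single l 1), _, rfl⟩
  let A : Matrix (Fin m) (Fin k) F := of fun i j => (b j : Fin m → F) i
  let B : Matrix (Fin k) (Fin n) F := of fun j l => b.repr (c l) j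
  have hAB : A * B = X := by
    ext i l
    have h := congrArg (fun v : LinearMap.range X.mulVecLin => (v : Fin m → F) i)
      (b.sum_repr (c l))
    calc (A * B) i l = ∑ j, b.repr (c l) j * (b j : Fin m → F) i := by
          simp [Matrix.mul_apply, A, B, mul_comm]
      _ = (c l : Fin m → F) i := by
          rw [← h, Submodule.coe_sum, Finset.sum_apply]
          rfl
      _ = X i l := by simp [c]
  refine ⟨A, B, le_antisymm (rank_le_width A) ?_, le_antisymm (rank_le_height B) ?_, hAB⟩
  · exact (hAB ▸ hX).symm.le.trans (rank_mul_le_left A B)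
  · exact (hAB ▸ hX).symm.le.trans (rank_mul_le_right A B)

/-- Two rank factorizations of the same matrix differ by an invertible matrix. -/
lemma exists_unit_of_mul_eq_mul {A A' : Matrix (Fin m) (Fin k) F}
    {B B' : Matrix (Fin k) (Fin n) F} (hA' : A'.rank = k)
    (hB' : B'.rank = k) (h : A * B = A' * B') :
    ∃ g : GL (Fin k) F, A * g.1 = A' ∧ g⁻¹.1 * B = B' := by
  obtain ⟨C', hC'⟩ := exists_left_inverse_of_rank_eq_width hA'
  obtain ⟨D', hD'⟩ := exists_right_inverse_of_rank_eq_height hB'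
  have hAg : A * (B * D') = A' := by
    rw [← Matrix.mul_assoc, h, Matrix.mul_assoc, hD', Matrix.mul_one]
  have hgB : (C' * A) * B = B' := by
    rw [Matrix.mul_assoc, h, ← Matrix.mul_assoc, hC', Matrix.one_mul]
  have hinv : (C' * A) * (B * D') = 1 := by rw [Matrix.mul_assoc, hAg, hC']
  exact ⟨⟨B * D', C' * A, mul_eq_one_comm.mp hinv, hinv⟩, hAg, hgB⟩

lemma card_rank_eq_mul_card_GL [Finite F] :
    Nat.card {X : Matrix (Fin m) (Fin n) F // X.rank = k} * Nat.card (GL (Fin k) F) =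
      Nat.card {A : Matrix (Fin m) (Fin k) F // A.rank = k} *
        Nat.card {B : Matrix (Fin k) (Fin n) F // B.rank = k} := by
  choose A B hA hB hAB using fun X : {X : Matrix (Fin m) (Fin n) F // X.rank = k} =>
    exists_rank_factorization X.2
  rw [← Nat.card_prod, ← Nat.card_prod]
  have hdet (g : GL (Fin k) F) : IsUnit g.1.det := (isUnit_iff_isUnit_det _).mp g.isUnit
  let f (p : {X : Matrix (Fin m) (Fin n) F // X.rank = k} × GL (Fin k) F) :
      {A : Matrix (Fin m) (Fin k) F // A.rank = k} ×
        {B : Matrix (Fin k) (Fin n) F // B.rank = k} :=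
    (⟨A p.1 * p.2.1, by rw [rank_mul_eq_left_of_isUnit_det _ _ (hdet _), hA]⟩,
      ⟨p.2⁻¹.1 * B p.1, by rw [rank_mul_eq_right_of_isUnit_det _ _ (hdet _), hB]⟩)
  have hf (p) : (f p).1.1 * (f p).2.1 = p.1.1 := by
    change A p.1 * p.2.1 * (p.2⁻¹.1 * B p.1) = p.1.1
    rw [Matrix.mul_assoc, ← Matrix.mul_assoc p.2.1, Units.mul_inv, Matrix.one_mul, hAB]
  refine Nat.card_congr (Equiv.ofBijective f ⟨?_, ?_⟩)
  · rintro ⟨X, g⟩ ⟨Y, h⟩ hfe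
    obtain rfl : X = Y := Subtype.ext (by rw [← hf (X, g), hfe, hf])
    obtain ⟨C, hC⟩ := exists_left_inverse_of_rank_eq_width (hA X)
    have hgh : A X * g.1 = A X * h.1 := congrArg (fun p => p.1.1) hfe
    have hgh' := congrArg (C * ·) hgh
    simp only [← Matrix.mul_assoc, hC, Matrix.one_mul] at hgh'
    rw [Units.ext hgh']
  · rintro ⟨⟨A', hA'⟩, ⟨B', hB'⟩⟩
    let X : {X : Matrix (Fin m) (Fin n) F // X.rank = k} :=
      ⟨A' * B', rank_mul_eq_of_rank_eq_inner hA' hB'⟩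
    obtain ⟨g, h₁, h₂⟩ := exists_unit_of_mul_eq_mul hA' hB' (hAB X)
    exact ⟨(X, g), Prod.ext (Subtype.ext h₁) (Subtype.ext h₂)⟩

lemma card_rank_eq_height [Fintype F] (hk : k ≤ n) :
    Nat.card {B : Matrix (Fin k) (Fin n) F // B.rank = k} =
      ∏ i : Fin k, (Fintype.card F ^ n - Fintype.card F ^ i.val) := by
  have h := card_linearIndependent (K := F) (V := Fin n → F) (k := k) (by simpa using hk)
  rw [Module.finrank_fin_fun] at h
  rw [← h]
  refine Nat.card_congr (of.symm.subtypeEquiv fun B => ?_)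
  change _ ↔ LinearIndependent F B.row
  rw [linearIndependent_iff_card_eq_finrank_span, Fintype.card_fin, Set.finrank,
    rank_eq_finrank_span_row, eq_comm]

lemma card_rank_eq_width [Fintype F] (hk : k ≤ m) :
    Nat.card {A : Matrix (Fin m) (Fin k) F // A.rank = k} =
      ∏ i : Fin k, (Fintype.card F ^ m - Fintype.card F ^ i.val) := by
  rw [← card_rank_eq_height hk]
  exact Nat.card_congr ((transposeAddEquiv _ _ F).toEquiv.subtypeEquiv fun A => by
    simp [rank_transpose])

end RankFactorization

end Matrix

lemma cast_prod_pow_sub_pow {q n k : ℕ} (hq : 0 < q) (hk : k ≤ n) :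
    ((∏ i : Fin k, (q ^ n - q ^ i.val) : ℕ) : ℚ) = ∏ i ∈ range k, ((q : ℚ) ^ n - (q : ℚ) ^ i) := by
  rw [Fin.prod_univ_eq_prod_range (fun i => q ^ n - q ^ i), Nat.cast_prod]
  refine prod_congr rfl fun i hi => ?_
  rw [Nat.cast_sub (Nat.pow_le_pow_right hq ((mem_range.mp hi).le.trans hk))]
  simp

lemma prod_pow_sub_pow_eq_qPoch_inv {q : ℚ} (hq : q ≠ 0) (n k : ℕ) :
    ∏ i ∈ range k, (q ^ n - q ^ i) = q ^ (n * k) * qPoch q (q ^ n)⁻¹ k := by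
  have h : q ^ (n * k) = ∏ i ∈ range k, q ^ n := by simp [pow_mul]
  rw [qPoch, h, ← prod_mul_distrib]
  refine prod_congr rfl fun i _ => ?_
  field_simp

lemma prod_pow_sub_pow_eq_qPoch_self (q : ℚ) (k : ℕ) :
    ∏ i ∈ range k, (q ^ k - q ^ i) = (-1) ^ k * q ^ (k * (k - 1) / 2) * qPoch q q k := by
  have h : ∏ i ∈ range k, (q ^ k - q ^ i) = ∏ i ∈ range k, (-1) * q ^ i * (1 - q ^ (k - i)) :=
    prod_congr rfl fun i hi => by
      rw [mul_sub, mul_assoc, mul_assoc, ← pow_add, Nat.add_sub_cancel' (mem_range.mp hi).le]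
      ring
  rw [h, prod_mul_distrib, prod_mul_distrib, prod_const, card_range, prod_pow_eq_pow_sum,
    sum_range_id, qPoch, ← prod_range_reflect]
  congr 1
  refine prod_congr rfl fun i hi => ?_
  have hi := mem_range.mp hi
  rw [← pow_succ']
  congr 2
  omega

theorem landsberg_formula {q n k : ℕ} (hq : IsPrimePow q)
    (F : Type*) [Field F] [Fintype F] (hF : Fintype.card F = q) (hk : k ≤ n) :
    (acount F n k : ℚ) =
      (-1 : ℚ) ^ k * (qPoch (q : ℚ) (((q : ℚ) ^ n)⁻¹) k) ^ 2 *
        (q : ℚ) ^ (2 * n * k - k * (k - 1) / 2) / qPoch (q : ℚ) (q : ℚ) k := by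
  subst hF
  have hq1 : 1 < Fintype.card F := hq.one_lt
  have hcard := Matrix.card_rank_eq_mul_card_GL (F := F) (m := n) (n := n) (k := k)
  rw [Matrix.card_GL_field, Matrix.card_rank_eq_width hk, Matrix.card_rank_eq_height hk] at hcard
  replace hcard := congrArg (Nat.cast : ℕ → ℚ) hcard
  rw [Nat.cast_mul, Nat.cast_mul, cast_prod_pow_sub_pow hq1.le le_rfl,
    cast_prod_pow_sub_pow hq1.le hk] at hcard
  change (acount F n k : ℚ) * _ = _ at hcard
  generalize Fintype.card F = q at *
  have hq1' : (1 : ℚ) < q := by exact_mod_cast hq1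
  have hq0 : (q : ℚ) ≠ 0 := by positivity
  rw [prod_pow_sub_pow_eq_qPoch_self, prod_pow_sub_pow_eq_qPoch_inv hq0] at hcard
  have hpoch : qPoch (q : ℚ) q k ≠ 0 := prod_ne_zero_iff.mpr fun i _ => by
    rw [← pow_succ']
    exact (sub_neg.mpr (one_lt_pow₀ hq1' i.succ_ne_zero)).ne
  have hle : k * (k - 1) / 2 ≤ 2 * n * k :=
    (Nat.div_le_self _ _).trans (by nlinarith [Nat.sub_le k 1])
  have hpow : (q : ℚ) ^ (2 * n * k - k * (k - 1) / 2) * (q : ℚ) ^ (k * (k - 1) / 2) =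
      (q : ℚ) ^ (n * k) * (q : ℚ) ^ (n * k) := by
    rw [← pow_add, ← pow_add, Nat.sub_add_cancel hle]
    congr 1
    ring
  have hsign : (-1 : ℚ) ^ k * (-1) ^ k = 1 := by rw [← mul_pow]; simp
  rw [eq_div_iff hpoch]
  refine mul_right_cancel₀ (pow_ne_zero (k * (k - 1) / 2) hq0) ?_
  linear_combination (-1 : ℚ) ^ k * hcard -
    (acount F n k * qPoch q q k * (q : ℚ) ^ (k * (k - 1) / 2)) * hsign -
    (-1 : ℚ) ^ k * qPoch q ((q : ℚ) ^ n)⁻¹ k ^ 2 * hpow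
end
end

section
/- Let q be a prime power, F a finite field with q elements, and n ≥ 1. Let ψ₀ : F → ℂ× be a nontrivial additive character. Let A, B ∈ M(n,F) with rank(A) = rank(B). Then for every finite-dimensional complex representation π : GL(2n,F) → GL(V), the dimension of {v ∈ V : π(u(X)) v = ψ₀(tr(A X)) · v for all X ∈ M(n,F)} equals the dimension of {v ∈ V : π(u(X)) v = ψ₀(tr(B X)) · v for all X ∈ M(n,F)}, where u(X) = [[I_n, X],[0, I_n]] ∈ GL(2n,F) is the block upper-triangular unipotent matrix with block X. -/
open Matrix Finset

noncomputable section

/-- Two square matrices over a field with the same rank are equivalent. -/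
theorem exists_units_mul_mul_eq_of_rank_eq {K m : Type*} [Field K] [Fintype m] [DecidableEq m]
    {A B : Matrix m m K} (h : A.rank = B.rank) :
    ∃ P Q : (Matrix m m K)ˣ, (P : Matrix m m K) * A * (Q : Matrix m m K) = B := by
  obtain ⟨V, U, e, hV, hU, hA⟩ := Matrix.exists_rank_normal_form A
  obtain ⟨V', U', e', hV', hU', hB⟩ := Matrix.exists_rank_normal_form B
  revert e
  rw [h]
  intro e hA
  let σ : m ≃ m := e'.trans e.symm
  have hσ : V.submatrix σ id * A * U.submatrix id σ = V' * B * U' := by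
    have hsub : V.submatrix σ id * A * U.submatrix id σ = (V * A * U).submatrix σ σ := by
      ext i j
      simp [Matrix.mul_apply]
    rw [hsub, hA, hB, Matrix.submatrix_submatrix]
    congr 1 <;> ext i <;> simp [σ]
  have hVσ : IsUnit (V.submatrix σ id) := (Matrix.isUnit_submatrix_equiv σ (Equiv.refl m)).2 hV
  have hUσ : IsUnit (U.submatrix id σ) := (Matrix.isUnit_submatrix_equiv (Equiv.refl m) σ).2 hU
  obtain ⟨v, hv⟩ := hVσ
  obtain ⟨u, hu⟩ := hUσ
  obtain ⟨v', rfl⟩ := hV'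
  obtain ⟨u', rfl⟩ := hU'
  rw [← hv, ← hu] at hσ
  refine ⟨v'⁻¹ * v, u * u'⁻¹, ?_⟩
  calc ((v'⁻¹ * v : (Matrix m m K)ˣ) : Matrix m m K) * A * ((u * u'⁻¹ : (Matrix m m K)ˣ))
      = (v'⁻¹ : (Matrix m m K)ˣ) * (v * A * u) * (u'⁻¹ : (Matrix m m K)ˣ) := by
        simp only [Units.val_mul, mul_assoc]
    _ = B := by rw [hσ]; simp [← mul_assoc]

/-- The block diagonal matrix `[[g, 0], [0, h]]` as an element of `GL(2n, F)`. -/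
def blockDiagUnit {F : Type*} [Field F] {n : ℕ} (g h : (Matrix (Fin n) (Fin n) F)ˣ) :
    (Matrix (Fin n ⊕ Fin n) (Fin n ⊕ Fin n) F)ˣ where
  val := Matrix.fromBlocks g 0 0 h
  inv := Matrix.fromBlocks (g⁻¹ : (Matrix (Fin n) (Fin n) F)ˣ) 0 0
    (h⁻¹ : (Matrix (Fin n) (Fin n) F)ˣ)
  val_inv := by rw [Matrix.fromBlocks_multiply]; simp
  inv_val := by rw [Matrix.fromBlocks_multiply]; simp

theorem uMat_mul_blockDiagUnit {F : Type*} [Field F] {n : ℕ} (P Q : (Matrix (Fin n) (Fin n) F)ˣ)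
    (X : Matrix (Fin n) (Fin n) F) :
    uMat ((Q : Matrix (Fin n) (Fin n) F) * X * (P : Matrix (Fin n) (Fin n) F)) *
      blockDiagUnit Q P⁻¹ = blockDiagUnit Q P⁻¹ * uMat X := by
  ext1
  simp [uMat, blockDiagUnit, Matrix.fromBlocks_multiply, mul_assoc]

/-- The `ψ_A`-eigenspace of `{uMat X}` has the dimension of the `ψ_{PAQ}`-eigenspace:
`diag(Q, P⁻¹)` exchanges them. -/
theorem finrank_iInf_eigenspace_uMat_mul_mul {F : Type*} [Field F] {n : ℕ}
    (ψ₀ : AddChar F ℂˣ) (A : Matrix (Fin n) (Fin n) F) (P Q : (Matrix (Fin n) (Fin n) F)ˣ)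
    {V : Type*} [AddCommGroup V] [Module ℂ V]
    (π : Representation ℂ ((Matrix (Fin n ⊕ Fin n) (Fin n ⊕ Fin n) F)ˣ) V) :
    Module.finrank ℂ
        ↥(⨅ X : Matrix (Fin n) (Fin n) F,
          Module.End.eigenspace (π (uMat X))
            ((ψ₀ (Matrix.trace (A * X)) : ℂˣ) : ℂ)) =
      Module.finrank ℂ
        ↥(⨅ X : Matrix (Fin n) (Fin n) F,
          Module.End.eigenspace (π (uMat X))
            ((ψ₀ (Matrix.trace ((P : Matrix (Fin n) (Fin n) F) * A *
              (Q : Matrix (Fin n) (Fin n) F) * X)) : ℂˣ) : ℂ)) := by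
  let d := blockDiagUnit Q P⁻¹
  let e : V ≃ₗ[ℂ] V := LinearEquiv.ofLinearMap (π d) (π d⁻¹)
    (by rw [← Module.End.mul_eq_comp, ← map_mul]; simp; rfl)
    (by rw [← Module.End.mul_eq_comp, ← map_mul]; simp; rfl)
  have htr (X : Matrix (Fin n) (Fin n) F) :
      Matrix.trace ((P : Matrix (Fin n) (Fin n) F) * A * (Q : Matrix (Fin n) (Fin n) F) * X) =
        Matrix.trace (A * ((Q : Matrix (Fin n) (Fin n) F) * X * (P : Matrix (Fin n) (Fin n) F))) := by
    rw [mul_assoc, mul_assoc, Matrix.trace_mul_comm]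
    simp only [mul_assoc]
  have hcomm (X : Matrix (Fin n) (Fin n) F) (v : V) :
      π (uMat ((Q : Matrix (Fin n) (Fin n) F) * X * (P : Matrix (Fin n) (Fin n) F))) (e v) =
        e (π (uMat X) v) := by
    change (π _ * π d) v = (π d * π _) v
    rw [← map_mul, ← map_mul, uMat_mul_blockDiagUnit]
  have hsurj : Function.Surjective fun X : Matrix (Fin n) (Fin n) F ↦
      (Q : Matrix (Fin n) (Fin n) F) * X * (P : Matrix (Fin n) (Fin n) F) := fun Y ↦
    ⟨(Q⁻¹ : (Matrix (Fin n) (Fin n) F)ˣ) * Y * (P⁻¹ : (Matrix (Fin n) (Fin n) F)ˣ), by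
      simp [mul_assoc]⟩
  have hcomap : (⨅ X : Matrix (Fin n) (Fin n) F,
        Module.End.eigenspace (π (uMat X)) ((ψ₀ (Matrix.trace (A * X)) : ℂˣ) : ℂ)).comap
          (e : V →ₗ[ℂ] V) =
      ⨅ X : Matrix (Fin n) (Fin n) F, Module.End.eigenspace (π (uMat X))
        ((ψ₀ (Matrix.trace ((P : Matrix (Fin n) (Fin n) F) * A *
          (Q : Matrix (Fin n) (Fin n) F) * X)) : ℂˣ) : ℂ) := by
    ext v
    simp only [Submodule.mem_comap, Submodule.mem_iInf, Module.End.mem_eigenspace_iff,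
      LinearEquiv.coe_coe]
    refine hsurj.forall.trans (forall_congr' fun X ↦ ?_)
    rw [hcomm, htr, ← map_smul, e.injective.eq_iff]
  rw [← hcomap]
  exact (LinearEquiv.finrank_eq (e.ofSubmodule' _)).symm

theorem dim_twisted_jacquet_eq_of_rank_eq {q n : ℕ} (hq : IsPrimePow q)
    (F : Type*) [Field F] [Fintype F] (hF : Fintype.card F = q) (hn : 1 ≤ n)
    (ψ₀ : AddChar F ℂˣ) (hψ₀ : ψ₀ ≠ 1)
    (A B : Matrix (Fin n) (Fin n) F) (hAB : A.rank = B.rank)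
    (V : Type*) [AddCommGroup V] [Module ℂ V] [FiniteDimensional ℂ V]
    (π : Representation ℂ ((Matrix (Fin n ⊕ Fin n) (Fin n ⊕ Fin n) F)ˣ) V) :
    Module.finrank ℂ
        ↥(⨅ X : Matrix (Fin n) (Fin n) F,
          Module.End.eigenspace (π (uMat X))
            ((ψ₀ (Matrix.trace (A * X)) : ℂˣ) : ℂ)) =
      Module.finrank ℂ
        ↥(⨅ X : Matrix (Fin n) (Fin n) F,
          Module.End.eigenspace (π (uMat X))
            ((ψ₀ (Matrix.trace (B * X)) : ℂˣ) : ℂ)) := by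
  obtain ⟨P, Q, rfl⟩ := exists_units_mul_mul_eq_of_rank_eq hAB
  exact finrank_iInf_eigenspace_uMat_mul_mul ψ₀ A P Q π
end
end
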